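/- arXiv:2507.01812 — 5 statements merged into one kernel-verified Lean document; each statement's English description precedes it below -/
import Mathlib

section
/- Let γ ≥ 0, x₀ ∈ ℝ, and p₀, h₀ ∈ ℝ with h₀ > p₀²; set g₀ = √(h₀ − p₀²). Let p₊ and p₋ be the explicit rational functions p₊(x) = (p₀ + (x−x₀)(g₀² − p₀² − γ g₀ p₀)) / (−g₀²(x−x₀)² + (p₀(x−x₀) − 1)² + γ g₀(x−x₀)(p₀(x−x₀) − 1)) and p₋(x) = (p₀ + (x−x₀)(g₀² − p₀² + γ g₀ p₀)) / (−g₀²(x−x₀)² + (p₀(x−x₀) − 1)² − γ g₀(x−x₀)(p₀(x−x₀) − 1)). Then on any open interval containing x₀ on which the respective denominator is positive, p₊ and p₋ are smooth, satisfy p₊(x₀) = p₋(x₀) = p₀ and p₊'(x₀) = p₋'(x₀) = h₀, satisfy p₊' − p₊² > 0 and p₋' − p₋² > 0, and solve the differential equations p₊'' = 6 p₊' p₊ − 4 p₊³ + 2γ(p₊' − p₊²)^{3/2} and p₋'' = 6 p₋' p₋ − 4 p₋³ − 2γ(p₋' − p₋²)^{3/2}, respectively. -/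
/-- Denominator of the extremal solution p₊. -/
noncomputable def denomPlus (γ x₀ p₀ g₀ x : ℝ) : ℝ :=
  -g₀ ^ 2 * (x - x₀) ^ 2 + (p₀ * (x - x₀) - 1) ^ 2 + γ * g₀ * (x - x₀) * (p₀ * (x - x₀) - 1)

/-- Denominator of the extremal solution p₋. -/
noncomputable def denomMinus (γ x₀ p₀ g₀ x : ℝ) : ℝ :=
  -g₀ ^ 2 * (x - x₀) ^ 2 + (p₀ * (x - x₀) - 1) ^ 2 - γ * g₀ * (x - x₀) * (p₀ * (x - x₀) - 1)

/-- The extremal solution p₊ of p'' = 6p'p − 4p³ + 2γ(p'−p²)^{3/2}. -/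
noncomputable def pPlus (γ x₀ p₀ g₀ x : ℝ) : ℝ :=
  (p₀ + (x - x₀) * (g₀ ^ 2 - p₀ ^ 2 - γ * g₀ * p₀)) / denomPlus γ x₀ p₀ g₀ x

/-- The extremal solution p₋ of p'' = 6p'p − 4p³ − 2γ(p'−p²)^{3/2}. -/
noncomputable def pMinus (γ x₀ p₀ g₀ x : ℝ) : ℝ :=
  (p₀ + (x - x₀) * (g₀ ^ 2 - p₀ ^ 2 + γ * g₀ * p₀)) / denomMinus γ x₀ p₀ g₀ x

theorem hasDerivAt_denomPlus (γ x₀ p₀ g₀ x : ℝ) :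
    HasDerivAt (denomPlus γ x₀ p₀ g₀)
      (-2 * (p₀ + (x - x₀) * (g₀ ^ 2 - p₀ ^ 2 - γ * g₀ * p₀)) - γ * g₀) x := by
  have ht : HasDerivAt (fun y : ℝ => y - x₀) 1 x := (hasDerivAt_id x).sub_const x₀
  have hl : HasDerivAt (fun y : ℝ => p₀ * (y - x₀) - 1) (p₀ * 1) x :=
    (ht.const_mul p₀).sub_const 1
  have h := (((ht.pow 2).const_mul (-g₀ ^ 2)).add (hl.pow 2)).add
    ((ht.const_mul (γ * g₀)).mul hl)
  refine h.congr_deriv ?_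
  push_cast
  ring

theorem hasDerivAt_pPlus (γ x₀ p₀ g₀ x : ℝ) (hD : denomPlus γ x₀ p₀ g₀ x ≠ 0) :
    HasDerivAt (pPlus γ x₀ p₀ g₀)
      (pPlus γ x₀ p₀ g₀ x ^ 2 + (g₀ / denomPlus γ x₀ p₀ g₀ x) ^ 2) x := by
  have ht : HasDerivAt (fun y : ℝ => y - x₀) 1 x := (hasDerivAt_id x).sub_const x₀
  have hN := (ht.mul_const (g₀ ^ 2 - p₀ ^ 2 - γ * g₀ * p₀)).const_add p₀
  refine (hN.div (hasDerivAt_denomPlus γ x₀ p₀ g₀ x) hD).congr_deriv ?_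
  rw [pPlus, div_pow, div_pow, ← add_div]
  congr 1
  rw [denomPlus]
  ring

theorem hasDerivAt_div_denomPlus (γ x₀ p₀ g₀ x : ℝ) (hD : denomPlus γ x₀ p₀ g₀ x ≠ 0) :
    HasDerivAt (fun y => g₀ / denomPlus γ x₀ p₀ g₀ y)
      (2 * pPlus γ x₀ p₀ g₀ x * (g₀ / denomPlus γ x₀ p₀ g₀ x)
        + γ * (g₀ / denomPlus γ x₀ p₀ g₀ x) ^ 2) x := by
  refine ((hasDerivAt_const x g₀).div (hasDerivAt_denomPlus γ x₀ p₀ g₀ x) hD).congr_deriv ?_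
  rw [pPlus]
  field_simp
  ring

theorem pow_two_rpow_three_halves {u : ℝ} (hu : 0 ≤ u) :
    (u ^ 2) ^ ((3 : ℝ) / 2) = u ^ 3 := by
  rw [← Real.rpow_natCast u 2, ← Real.rpow_mul hu, ← Real.rpow_natCast u 3]
  norm_num

/-- The properties of `pPlus`, for a parameter `γ` of arbitrary sign. -/
theorem pPlus_extremal (γ x₀ p₀ h₀ : ℝ) (hh₀ : p₀ ^ 2 < h₀)
    (g₀ : ℝ) (hg₀ : g₀ = Real.sqrt (h₀ - p₀ ^ 2)) (s : Set ℝ) (hs : IsOpen s) (hx₀ : x₀ ∈ s)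
    (hD : ∀ x ∈ s, 0 < denomPlus γ x₀ p₀ g₀ x) :
    ContDiffOn ℝ (⊤ : ℕ∞) (pPlus γ x₀ p₀ g₀) s ∧
    pPlus γ x₀ p₀ g₀ x₀ = p₀ ∧
    deriv (pPlus γ x₀ p₀ g₀) x₀ = h₀ ∧
    (∀ x ∈ s, 0 < deriv (pPlus γ x₀ p₀ g₀) x - (pPlus γ x₀ p₀ g₀ x) ^ 2) ∧
    (∀ x ∈ s,
      deriv (deriv (pPlus γ x₀ p₀ g₀)) x =
        6 * deriv (pPlus γ x₀ p₀ g₀) x * pPlus γ x₀ p₀ g₀ x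
          - 4 * (pPlus γ x₀ p₀ g₀ x) ^ 3
          + 2 * γ * (deriv (pPlus γ x₀ p₀ g₀) x
            - (pPlus γ x₀ p₀ g₀ x) ^ 2) ^ ((3 : ℝ) / 2)) := by
  have hg : 0 < g₀ := hg₀ ▸ Real.sqrt_pos.2 (sub_pos.2 hh₀)
  have hg2 : g₀ ^ 2 = h₀ - p₀ ^ 2 := by rw [hg₀, Real.sq_sqrt (sub_pos.2 hh₀).le]
  have hderiv : ∀ x ∈ s, deriv (pPlus γ x₀ p₀ g₀) x =
      pPlus γ x₀ p₀ g₀ x ^ 2 + (g₀ / denomPlus γ x₀ p₀ g₀ x) ^ 2 :=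
    fun x hx => (hasDerivAt_pPlus γ x₀ p₀ g₀ x (hD x hx).ne').deriv
  have hinit : pPlus γ x₀ p₀ g₀ x₀ = p₀ := by simp [pPlus, denomPlus]
  refine ⟨?_, hinit, ?_, fun x hx => ?_, fun x hx => ?_⟩
  · refine ContDiffOn.div ?_ ?_ fun x hx => (hD x hx).ne'
    · fun_prop
    · unfold denomPlus
      fun_prop
  · rw [hderiv x₀ hx₀, hinit]
    simp [denomPlus, hg2]
  · rw [hderiv x hx, add_sub_cancel_left]
    exact pow_pos (div_pos hg (hD x hx)) 2
  · have hDx := hD x hx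
    have hp := hasDerivAt_pPlus γ x₀ p₀ g₀ x hDx.ne'
    have hq := hasDerivAt_div_denomPlus γ x₀ p₀ g₀ x hDx.ne'
    have heq : deriv (pPlus γ x₀ p₀ g₀) =ᶠ[nhds x]
        (pPlus γ x₀ p₀ g₀) ^ 2 + (fun y => g₀ / denomPlus γ x₀ p₀ g₀ y) ^ 2 :=
      Filter.eventually_of_mem (hs.mem_nhds hx) hderiv
    rw [heq.deriv_eq, ((hp.pow 2).add (hq.pow 2)).deriv, hderiv x hx, add_sub_cancel_left,
      pow_two_rpow_three_halves (div_pos hg hDx).le]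
    ring

theorem denomMinus_eq_denomPlus_neg (γ x₀ p₀ g₀ : ℝ) :
    denomMinus γ x₀ p₀ g₀ = denomPlus (-γ) x₀ p₀ g₀ := by
  funext x
  rw [denomMinus, denomPlus]
  ring

theorem pMinus_eq_pPlus_neg (γ x₀ p₀ g₀ : ℝ) :
    pMinus γ x₀ p₀ g₀ = pPlus (-γ) x₀ p₀ g₀ := by
  funext x
  rw [pMinus, pPlus, denomMinus_eq_denomPlus_neg]
  congr 1
  ring

/-- On any open interval containing x₀ on which the respective denominator is
positive, the explicit rational functions p₊ and p₋ are smooth, take the initial values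
p±(x₀) = p₀, p±'(x₀) = h₀, satisfy p±' − p±² > 0, and solve the differential equations
p₊'' = 6p₊'p₊ − 4p₊³ + 2γ(p₊'−p₊²)^{3/2} and p₋'' = 6p₋'p₋ − 4p₋³ − 2γ(p₋'−p₋²)^{3/2}. -/
theorem stmt_2 (γ : ℝ) (hγ : 0 ≤ γ) (x₀ p₀ h₀ : ℝ) (hh₀ : p₀ ^ 2 < h₀)
    (g₀ : ℝ) (hg₀ : g₀ = Real.sqrt (h₀ - p₀ ^ 2)) (a b : ℝ) (hx₀ : x₀ ∈ Set.Ioo a b) :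
    ((∀ x ∈ Set.Ioo a b, 0 < denomPlus γ x₀ p₀ g₀ x) →
      ContDiffOn ℝ (⊤ : ℕ∞) (pPlus γ x₀ p₀ g₀) (Set.Ioo a b) ∧
      pPlus γ x₀ p₀ g₀ x₀ = p₀ ∧
      deriv (pPlus γ x₀ p₀ g₀) x₀ = h₀ ∧
      (∀ x ∈ Set.Ioo a b,
        0 < deriv (pPlus γ x₀ p₀ g₀) x - (pPlus γ x₀ p₀ g₀ x) ^ 2) ∧
      (∀ x ∈ Set.Ioo a b,
        deriv (deriv (pPlus γ x₀ p₀ g₀)) x =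
          6 * deriv (pPlus γ x₀ p₀ g₀) x * pPlus γ x₀ p₀ g₀ x
            - 4 * (pPlus γ x₀ p₀ g₀ x) ^ 3
            + 2 * γ * (deriv (pPlus γ x₀ p₀ g₀) x - (pPlus γ x₀ p₀ g₀ x) ^ 2) ^ ((3 : ℝ) / 2))) ∧
    ((∀ x ∈ Set.Ioo a b, 0 < denomMinus γ x₀ p₀ g₀ x) →
      ContDiffOn ℝ (⊤ : ℕ∞) (pMinus γ x₀ p₀ g₀) (Set.Ioo a b) ∧
      pMinus γ x₀ p₀ g₀ x₀ = p₀ ∧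
      deriv (pMinus γ x₀ p₀ g₀) x₀ = h₀ ∧
      (∀ x ∈ Set.Ioo a b,
        0 < deriv (pMinus γ x₀ p₀ g₀) x - (pMinus γ x₀ p₀ g₀ x) ^ 2) ∧
      (∀ x ∈ Set.Ioo a b,
        deriv (deriv (pMinus γ x₀ p₀ g₀)) x =
          6 * deriv (pMinus γ x₀ p₀ g₀) x * pMinus γ x₀ p₀ g₀ x
            - 4 * (pMinus γ x₀ p₀ g₀ x) ^ 3
            - 2 * γ * (deriv (pMinus γ x₀ p₀ g₀) x - (pMinus γ x₀ p₀ g₀ x) ^ 2) ^ ((3 : ℝ) / 2))) := by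
  refine ⟨pPlus_extremal γ x₀ p₀ h₀ hh₀ g₀ hg₀ _ isOpen_Ioo hx₀, fun hD => ?_⟩
  rw [denomMinus_eq_denomPlus_neg] at hD
  simpa only [pMinus_eq_pPlus_neg, mul_neg, neg_mul, ← sub_eq_add_neg] using
    pPlus_extremal (-γ) x₀ p₀ h₀ hh₀ g₀ hg₀ _ isOpen_Ioo hx₀ hD
end

section
/- Let ν ≥ 2, γ = (ν−2)/√(ν−1), let f : (−1,1) → ℝ be a C³ function, and let x ∈ (−1,1). Set p = f'(x), h = f''(x), w = f'''(x) and define p̃ = (1−x²)p − x, h̃ = (1−x²)²h − 2x(1−x²)p + x², w̃ = (1−x²)³w − 6x(1−x²)²h + 6x²(1−x²)p − 2x³. Then: (1) the pair of condition chains √(h − p²)/√(ν−1) ≤ p + 1/(1+x) ≤ √(ν−1)·√(h − p²) and √(h − p²)/√(ν−1) ≤ −p + 1/(1−x) ≤ √(ν−1)·√(h − p²) holds if and only if √(h̃ − p̃²)/√(ν−1) ≤ 1 + p̃ ≤ √(ν−1)·√(h̃ − p̃²) and √(h̃ − p̃²)/√(ν−1) ≤ 1 − p̃ ≤ √(ν−1)·√(h̃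 − p̃²); and (2) the condition |w − 6hp + 4p³| ≤ 2γ(h − p²)^{3/2} holds if and only if |w̃ − 6h̃p̃ + 4p̃³| ≤ 2γ(h̃ − p̃²)^{3/2}. -/
/-- Unlike `Real.mul_rpow`, no sign is assumed for the second factor. -/
theorem Real.mul_rpow_of_pos_left {c : ℝ} (hc : 0 < c) (D z : ℝ) :
    (c * D) ^ z = c ^ z * D ^ z := by
  rcases le_or_gt 0 D with hD | hD
  · exact Real.mul_rpow hc.le hD
  · rw [Real.rpow_def_of_neg (mul_neg_of_pos_of_neg hc hD), Real.rpow_def_of_neg hD,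
      Real.rpow_def_of_pos hc, Real.log_mul hc.ne' hD.ne, add_mul, Real.exp_add, mul_assoc]


/-- For a C³ function f on (−1,1) and x ∈ (−1,1), with p = f'(x), h = f''(x),
w = f'''(x) and the centered quantities p̃ = (1−x²)p − x, h̃ = (1−x²)²h − 2x(1−x²)p + x²,
w̃ = (1−x²)³w − 6x(1−x²)²h + 6x²(1−x²)p − 2x³: the two chains of inequalities at x are
equivalent to the centered chains, and the self-concordance inequality
|w − 6hp + 4p³| ≤ 2γ(h−p²)^{3/2} is equivalent to its centered counterpart. -/
theorem stmt_8 (ν : ℝ) (hν : 2 ≤ ν) (γ : ℝ) (hγ : γ = (ν - 2) / Real.sqrt (ν - 1))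
    (f : ℝ → ℝ) (hf : ContDiffOn ℝ 3 f (Set.Ioo (-1 : ℝ) 1))
    (x : ℝ) (hx : x ∈ Set.Ioo (-1 : ℝ) 1)
    (p h w pt ht wt : ℝ)
    (hp : p = deriv f x) (hh : h = iteratedDeriv 2 f x) (hw : w = iteratedDeriv 3 f x)
    (hpt : pt = (1 - x ^ 2) * p - x)
    (hht : ht = (1 - x ^ 2) ^ 2 * h - 2 * x * (1 - x ^ 2) * p + x ^ 2)
    (hwt : wt = (1 - x ^ 2) ^ 3 * w - 6 * x * (1 - x ^ 2) ^ 2 * h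
        + 6 * x ^ 2 * (1 - x ^ 2) * p - 2 * x ^ 3) :
    ((Real.sqrt (h - p ^ 2) / Real.sqrt (ν - 1) ≤ p + 1 / (1 + x) ∧
        p + 1 / (1 + x) ≤ Real.sqrt (ν - 1) * Real.sqrt (h - p ^ 2) ∧
        Real.sqrt (h - p ^ 2) / Real.sqrt (ν - 1) ≤ -p + 1 / (1 - x) ∧
        -p + 1 / (1 - x) ≤ Real.sqrt (ν - 1) * Real.sqrt (h - p ^ 2)) ↔
      (Real.sqrt (ht - pt ^ 2) / Real.sqrt (ν - 1) ≤ 1 + pt ∧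
        1 + pt ≤ Real.sqrt (ν - 1) * Real.sqrt (ht - pt ^ 2) ∧
        Real.sqrt (ht - pt ^ 2) / Real.sqrt (ν - 1) ≤ 1 - pt ∧
        1 - pt ≤ Real.sqrt (ν - 1) * Real.sqrt (ht - pt ^ 2))) ∧
    ((|w - 6 * h * p + 4 * p ^ 3| ≤ 2 * γ * (h - p ^ 2) ^ ((3 : ℝ) / 2)) ↔
      (|wt - 6 * ht * pt + 4 * pt ^ 3| ≤ 2 * γ * (ht - pt ^ 2) ^ ((3 : ℝ) / 2))) := by
  obtain ⟨hx1, hx2⟩ := hx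
  have hplus : 0 < 1 + x := by linarith
  have hminus : 0 < 1 - x := by linarith
  obtain ⟨c, hc⟩ : ∃ c, c = 1 - x ^ 2 := ⟨_, rfl⟩
  have hc0 : 0 < c := by rw [hc]; nlinarith
  have hvar : ht - pt ^ 2 = c ^ 2 * (h - p ^ 2) := by rw [hht, hpt, hc]; ring
  have hthird : wt - 6 * ht * pt + 4 * pt ^ 3 = c ^ 3 * (w - 6 * h * p + 4 * p ^ 3) := by
    rw [hwt, hht, hpt, hc]; ring
  have hadd : 1 + pt = c * (p + 1 / (1 + x)) := by rw [hpt, hc]; field_simp; ring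
  have hsub : 1 - pt = c * (-p + 1 / (1 - x)) := by rw [hpt, hc]; field_simp; ring
  constructor
  · rw [hvar, hadd, hsub, Real.sqrt_mul (sq_nonneg c), Real.sqrt_sq hc0.le, mul_div_assoc,
      mul_left_comm (Real.sqrt (ν - 1)) c]
    simp only [mul_le_mul_iff_right₀ hc0]
  · have hpow : (c ^ 2) ^ ((3 : ℝ) / 2) = c ^ 3 := by
      rw [← Real.rpow_natCast_mul hc0.le, ← Real.rpow_natCast c 3]
      norm_num
    rw [hvar, hthird, Real.mul_rpow_of_pos_left (pow_pos hc0 2), hpow, abs_mul,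
      abs_of_pos (pow_pos hc0 3), mul_left_comm (2 * γ) (c ^ 3),
      mul_le_mul_iff_right₀ (pow_pos hc0 3)]
end

section
/- Let ν ≥ 2 and let f : (−1,1) → ℝ be a C³ function. For every x ∈ (−1,1) set p = f'(x), h = f''(x), w = f'''(x) and define p̃ = (1−x²)p − x, h̃ = (1−x²)²h − 2x(1−x²)p + x², w̃ = (1−x²)³w − 6x(1−x²)²h + 6x²(1−x²)p − 2x³. Then the following are equivalent: (1) f satisfies the ν-barrier conditions on C = [−1,1]; (2) for every x ∈ (−1,1), the triple (p̃, h̃, w̃) is an element of the set P_ν. -/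
open Filter
/-- The body P_ν ⊂ ℝ³ from Corollary 1 (1DequivalenceBody). -/
noncomputable def Pset (ν : ℝ) : Set (ℝ × ℝ × ℝ) :=
  {q | Real.sqrt (q.2.1 - q.1 ^ 2) / Real.sqrt (ν - 1) ≤ 1 + q.1 ∧
    1 + q.1 ≤ Real.sqrt (ν - 1) * Real.sqrt (q.2.1 - q.1 ^ 2) ∧
    Real.sqrt (q.2.1 - q.1 ^ 2) / Real.sqrt (ν - 1) ≤ 1 - q.1 ∧
    1 - q.1 ≤ Real.sqrt (ν - 1) * Real.sqrt (q.2.1 - q.1 ^ 2) ∧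
    |q.2.2 - 6 * q.2.1 * q.1 + 4 * q.1 ^ 3| ≤
      2 * ((ν - 2) / Real.sqrt (ν - 1)) * (q.2.1 - q.1 ^ 2) ^ ((3 : ℝ) / 2)}

open Set Topology

lemma hasDerivAt_div_const_sub (l : ℝ) {R x : ℝ} (h : R - x ≠ 0) :
    HasDerivAt (fun x => l / (R - x)) (l / (R - x) ^ 2) x :=
  ((hasDerivAt_const x l).fun_div ((hasDerivAt_id' x).const_sub R) h).congr_deriv (by simp)

/-- A function with `c' ≥ c²` on `(-1, 1)` stays below the solution of `y' = y²` exploding at `1`. -/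
lemma mul_one_sub_le_one_of_sq_le_deriv {c c' : ℝ → ℝ}
    (hc : ∀ x ∈ Ioo (-1 : ℝ) 1, HasDerivAt c (c' x) x)
    (hle : ∀ x ∈ Ioo (-1 : ℝ) 1, c x ^ 2 ≤ c' x) {x₀ : ℝ} (hx₀ : x₀ ∈ Ioo (-1 : ℝ) 1) :
    c x₀ * (1 - x₀) ≤ 1 := by
  by_contra! hlt
  obtain ⟨h1, h2⟩ := hx₀
  have hcpos : 0 < c x₀ := by
    by_contra! h
    nlinarith
  obtain ⟨l, hl1, hl2⟩ := exists_between hlt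
  obtain ⟨R, hR, hlR⟩ : ∃ R, R < 1 ∧ c x₀ * (R - x₀) = l := by
    refine ⟨x₀ + l / c x₀, ?_, by field_simp; ring⟩
    have : l / c x₀ < 1 - x₀ := by
      rw [div_lt_iff₀ hcpos]
      linarith
    linarith
  have hxR : x₀ < R := by
    by_contra! h
    nlinarith
  have hcont : ContinuousOn c (Icc x₀ R) := fun x hx =>
    (hc x ⟨by linarith [hx.1], by linarith [hx.2]⟩).continuousAt.continuousWithinAt
  obtain ⟨M, hM⟩ := isCompact_Icc.bddAbove_image hcont
  have hM' : ∀ x ∈ Icc x₀ R, c x ≤ M := fun x hx => hM (mem_image_of_mem c hx)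
  have hbound : ∀ b ∈ Ioo x₀ R, l / (R - b) ≤ c b := by
    intro b hb
    have hne : ∀ x ∈ Icc x₀ b, 0 < R - x := fun x hx => by linarith [hx.2, hb.2]
    have hd : ∀ x ∈ Icc x₀ b, HasDerivAt (fun x => l / (R - x)) (l / (R - x) ^ 2) x :=
      fun x hx => hasDerivAt_div_const_sub l (hne x hx).ne'
    refine image_le_of_deriv_right_lt_deriv_boundary' (f' := fun x => l / (R - x) ^ 2) (B' := c')
      (fun x hx => (hd x hx).continuousAt.continuousWithinAt)
      (fun x hx => (hd x (Ico_subset_Icc_self hx)).hasDerivWithinAt) ?_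
      (hcont.mono (Icc_subset_Icc_right hb.2.le)) ?_ ?_ (right_mem_Icc.2 hb.1.le)
    · rw [div_le_iff₀ (by linarith), hlR]
    · intro x hx
      exact (hc x ⟨by linarith [hx.1], by linarith [hx.2, hb.2]⟩).hasDerivWithinAt
    · intro x hx hEq
      refine lt_of_lt_of_le ?_ (hle x ⟨by linarith [hx.1], by linarith [hx.2, hb.2]⟩)
      rw [← hEq, div_pow]
      have := hne x (Ico_subset_Icc_self hx)
      gcongr
      nlinarith
  have hMpos : 0 < M := hcpos.trans_le (hM' x₀ (left_mem_Icc.2 hxR.le))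
  obtain ⟨b, hb1, hb2⟩ : ∃ b, max x₀ (R - 1 / M) < b ∧ b < R :=
    exists_between (max_lt hxR (by simp [hMpos]))
  have hbx := (le_max_left _ _).trans_lt hb1
  have hbM := (le_max_right _ _).trans_lt hb1
  have hb := hbound b ⟨hbx, hb2⟩
  have hbM' := hM' b ⟨hbx.le, hb2.le⟩
  have h3 : R - b < 1 / M := by linarith
  rw [lt_div_iff₀ hMpos] at h3
  have h4 := (div_le_iff₀ (by linarith)).1 (hb.trans hbM')
  linarith

/-- If `d' ≤ d²` and `d` dominates the derivative of a function blowing up at `1`, then `d` stays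
above the solution of `y' = y²` exploding at `1`. -/
lemma one_le_mul_one_sub_of_deriv_le_sq {f p d d' : ℝ → ℝ}
    (hf : ∀ x ∈ Ioo (-1 : ℝ) 1, HasDerivAt f (p x) x)
    (hd : ∀ x ∈ Ioo (-1 : ℝ) 1, HasDerivAt d (d' x) x)
    (hle : ∀ x ∈ Ioo (-1 : ℝ) 1, d' x ≤ d x ^ 2) (hpd : ∀ x ∈ Ioo (-1 : ℝ) 1, p x ≤ d x)
    (hlim : Tendsto f (𝓝[Ioo (-1) 1] 1) atTop) {x₀ : ℝ} (hx₀ : x₀ ∈ Ioo (-1 : ℝ) 1) :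
    1 ≤ d x₀ * (1 - x₀) := by
  by_contra! hlt
  obtain ⟨h1, h2⟩ := hx₀
  obtain ⟨l, hl1, hl2⟩ : ∃ l, max (d x₀ * (1 - x₀)) 0 < l ∧ l < 1 :=
    exists_between (max_lt hlt one_pos)
  have hl0 : 0 < l := (le_max_right _ _).trans_lt hl1
  have hdl : d x₀ * (1 - x₀) < l := (le_max_left _ _).trans_lt hl1
  obtain ⟨R, hR, hdR⟩ : ∃ R, 1 < R ∧ d x₀ * (R - x₀) < l := by
    have hc : Tendsto (fun R : ℝ => d x₀ * (R - x₀)) (𝓝[>] 1) (𝓝 (d x₀ * (1 - x₀))) :=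
      (Continuous.tendsto (by fun_prop) 1).mono_left nhdsWithin_le_nhds
    exact ((eventually_mem_nhdsWithin (a := (1 : ℝ)) (s := Ioi 1)).and
      (hc.eventually_lt_const hdl)).exists
  have hcomp : ∀ b ∈ Ico x₀ 1, d b ≤ l / (R - b) := by
    intro b hb
    have hne : ∀ x ∈ Icc x₀ b, 0 < R - x := fun x hx => by linarith [hx.2, hb.2]
    have hB : ∀ x ∈ Icc x₀ b, HasDerivAt (fun x => l / (R - x)) (l / (R - x) ^ 2) x :=
      fun x hx => hasDerivAt_div_const_sub l (hne x hx).ne'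
    have hmem : ∀ x ∈ Icc x₀ b, x ∈ Ioo (-1 : ℝ) 1 := fun x hx =>
      ⟨by linarith [hx.1], by linarith [hx.2, hb.2]⟩
    refine image_le_of_deriv_right_lt_deriv_boundary' (f' := d') (B' := fun x => l / (R - x) ^ 2)
      (fun x hx => (hd x (hmem x hx)).continuousAt.continuousWithinAt)
      (fun x hx => (hd x (hmem x (Ico_subset_Icc_self hx))).hasDerivWithinAt) ?_
      (fun x hx => (hB x hx).continuousAt.continuousWithinAt)
      (fun x hx => (hB x (Ico_subset_Icc_self hx)).hasDerivWithinAt) ?_ (right_mem_Icc.2 hb.1)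
    · rw [le_div_iff₀ (by linarith)]
      exact hdR.le
    · intro x hx hEq
      refine lt_of_le_of_lt (hle x (hmem x (Ico_subset_Icc_self hx))) ?_
      rw [hEq, div_pow]
      have := hne x (Ico_subset_Icc_self hx)
      gcongr
      nlinarith
  set K := l / (R - 1) with hK
  have hKpos : 0 < K := div_pos hl0 (by linarith)
  have hfle : ∀ b ∈ Ico x₀ 1, f b ≤ f x₀ + (K + 1) * (b - x₀) := by
    intro b hb
    have hmem : ∀ x ∈ Icc x₀ b, x ∈ Ioo (-1 : ℝ) 1 := fun x hx =>
      ⟨by linarith [hx.1], by linarith [hx.2, hb.2]⟩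
    refine image_le_of_deriv_right_lt_deriv_boundary (f' := p) (B' := fun _ => K + 1)
      (B := fun x => f x₀ + (K + 1) * (x - x₀))
      (fun x hx => (hf x (hmem x hx)).continuousAt.continuousWithinAt)
      (fun x hx => (hf x (hmem x (Ico_subset_Icc_self hx))).hasDerivWithinAt) (by simp)
      (fun x => ?_) ?_ (right_mem_Icc.2 hb.1)
    · simpa using (((hasDerivAt_id x).sub_const x₀).const_mul (K + 1)).const_add (f x₀)
    · intro x hx _
      have h3 := hpd x (hmem x (Ico_subset_Icc_self hx))
      have h4 := hcomp x ⟨hx.1, hx.2.trans hb.2⟩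
      have h5 : l / (R - x) ≤ K := by
        rw [hK]
        have := hx.2.trans hb.2
        gcongr
      linarith
  have hnb : (𝓝[Ioo (-1 : ℝ) 1] 1).NeBot := by
    rw [← mem_closure_iff_nhdsWithin_neBot, closure_Ioo (by norm_num)]
    norm_num
  have hev : ∀ᶠ x in 𝓝[Ioo (-1 : ℝ) 1] 1, x₀ < x :=
    nhdsWithin_le_nhds (lt_mem_nhds h2)
  obtain ⟨x, hx, hxx, hxf⟩ := (eventually_mem_nhdsWithin.and
    (hev.and (hlim.eventually_gt_atTop (f x₀ + (K + 1) * (1 - x₀))))).exists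
  have h3 := hfle x ⟨hxx.le, hx.2⟩
  have h4 : (K + 1) * (x - x₀) ≤ (K + 1) * (1 - x₀) := by
    gcongr
    exact hx.2.le
  linarith

lemma tendsto_atTop_of_div_one_sub_le_deriv {f p : ℝ → ℝ} {a K : ℝ} (ha : 0 < a) (hK : 0 ≤ K)
    (hf : ∀ x ∈ Ioo (-1 : ℝ) 1, HasDerivAt f (p x) x)
    (hp : ∀ x ∈ Ico (0 : ℝ) 1, a / (1 - x) - K ≤ p x) :
    Tendsto f (𝓝[Ioo (-1) 1] 1) atTop := by
  have hF : ∀ x ∈ Ico (0 : ℝ) 1, HasDerivAt (fun x => f x + a * Real.log (1 - x) + K * x)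
      (p x + a * (-1 / (1 - x)) + K) x := by
    intro x hx
    have h1 := ((hasDerivAt_id' x).const_sub 1).log (sub_pos.2 hx.2).ne'
    exact (((hf x ⟨by linarith [hx.1], hx.2⟩).fun_add (h1.const_mul a)).fun_add
      ((hasDerivAt_id' x).const_mul K)).congr_deriv (by simp)
  have hmono : MonotoneOn (fun x => f x + a * Real.log (1 - x) + K * x) (Ico 0 1) := by
    refine monotoneOn_of_hasDerivWithinAt_nonneg (convex_Ico 0 1)
      (fun x hx => (hF x hx).continuousAt.continuousWithinAt)
      (fun x hx => (hF x (interior_subset hx)).hasDerivWithinAt) (fun x hx => ?_)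
    have := hp x (interior_subset hx)
    have h2 : a * (-1 / (1 - x)) = -(a / (1 - x)) := by ring
    linarith
  have hlog : Tendsto (fun x : ℝ => Real.log (1 - x)) (𝓝[Ioo (-1) 1] 1) atBot := by
    refine Real.tendsto_log_nhdsGT_zero.comp (tendsto_nhdsWithin_iff.2 ⟨?_, ?_⟩)
    · have : Tendsto (fun x : ℝ => 1 - x) (𝓝 1) (𝓝 (1 - 1)) :=
        Continuous.tendsto (by fun_prop) 1
      rw [sub_self] at this
      exact this.mono_left nhdsWithin_le_nhds
    · filter_upwards [eventually_mem_nhdsWithin] with x hx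
      simpa using hx.2
  have hbig : Tendsto (fun x : ℝ => (f 0 - K) + (-a) * Real.log (1 - x))
      (𝓝[Ioo (-1) 1] 1) atTop :=
    tendsto_atTop_add_const_left _ _ (hlog.const_mul_atBot_of_neg (by linarith))
  refine tendsto_atTop_mono' _ ?_ hbig
  have hev : ∀ᶠ x in 𝓝[Ioo (-1 : ℝ) 1] 1, 0 < x := nhdsWithin_le_nhds (lt_mem_nhds one_pos)
  filter_upwards [hev, eventually_mem_nhdsWithin] with x hx0 hx
  have h := hmono (left_mem_Ico.2 one_pos) ⟨hx0.le, hx.2⟩ hx0.le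
  simp only [sub_zero, Real.log_one, mul_zero, add_zero] at h
  nlinarith [hx.2]

lemma neg_mem_Ioo_neg_one_one {x : ℝ} (hx : x ∈ Ioo (-1 : ℝ) 1) : -x ∈ Ioo (-1 : ℝ) 1 :=
  ⟨by linarith [hx.2], by linarith [hx.1]⟩

lemma hasDerivAt_comp_neg {g g' : ℝ → ℝ} (hg : ∀ x ∈ Ioo (-1 : ℝ) 1, HasDerivAt g (g' x) x)
    (x : ℝ) (hx : x ∈ Ioo (-1 : ℝ) 1) : HasDerivAt (fun y => g (-y)) (-g' (-x)) x :=
  ((hg (-x) (neg_mem_Ioo_neg_one_one hx)).comp x (hasDerivAt_neg x)).congr_deriv (by simp)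

lemma tendsto_neg_nhdsWithin_Ioo (a : ℝ) :
    Tendsto (fun x : ℝ => -x) (𝓝[Ioo (-1) 1] a) (𝓝[Ioo (-1) 1] (-a)) :=
  tendsto_nhdsWithin_iff.2 ⟨(continuous_neg.tendsto a).mono_left nhdsWithin_le_nhds,
    eventually_mem_nhdsWithin.mono fun _ hx => neg_mem_Ioo_neg_one_one hx⟩

lemma hasDerivAt_iteratedDeriv_of_contDiffOn {f : ℝ → ℝ} {s : Set ℝ} (hs : IsOpen s) {n k : ℕ}
    (hf : ContDiffOn ℝ n f s) (hk : k < n) {x : ℝ} (hx : x ∈ s) :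
    HasDerivAt (iteratedDeriv k f) (iteratedDeriv (k + 1) f x) x := by
  have h1 := (hf.differentiableOn_iteratedDerivWithin (m := k) (by exact_mod_cast hk)
    hs.uniqueDiffOn).congr (fun y hy => (iteratedDerivWithin_of_isOpen hs hy).symm)
  rw [iteratedDeriv_succ]
  exact ((h1 x hx).differentiableAt (hs.mem_nhds hx)).hasDerivAt

/-- Membership in `Pset ν` after the centering projective change of variables, with the factors
`1 ± x` cancelled. -/
lemma centered_mem_Pset_iff {ν x p h w : ℝ} (hx : x ∈ Ioo (-1 : ℝ) 1) :
    ((1 - x ^ 2) * p - x, (1 - x ^ 2) ^ 2 * h - 2 * x * (1 - x ^ 2) * p + x ^ 2,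
        (1 - x ^ 2) ^ 3 * w - 6 * x * (1 - x ^ 2) ^ 2 * h + 6 * x ^ 2 * (1 - x ^ 2) * p
          - 2 * x ^ 3) ∈ Pset ν ↔
      0 < h - p ^ 2 ∧
      (√(h - p ^ 2) / √(ν - 1) - p) * (1 + x) ≤ 1 ∧
      1 ≤ (√(ν - 1) * √(h - p ^ 2) - p) * (1 + x) ∧
      (√(h - p ^ 2) / √(ν - 1) + p) * (1 - x) ≤ 1 ∧
      1 ≤ (√(ν - 1) * √(h - p ^ 2) + p) * (1 - x) ∧
      |w - 6 * h * p + 4 * p ^ 3| ≤ 2 * ((ν - 2) / √(ν - 1)) * (h - p ^ 2) ^ ((3 : ℝ) / 2) := by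
  obtain ⟨h1, h2⟩ := hx
  have hp1 : 0 < 1 + x := by linarith
  have hm1 : 0 < 1 - x := by linarith
  have hD : 0 < 1 - x ^ 2 := by nlinarith
  have e1 : (1 - x ^ 2) ^ 2 * h - 2 * x * (1 - x ^ 2) * p + x ^ 2 - ((1 - x ^ 2) * p - x) ^ 2 =
      (1 - x ^ 2) ^ 2 * (h - p ^ 2) := by ring
  have e2 : (1 - x ^ 2) ^ 3 * w - 6 * x * (1 - x ^ 2) ^ 2 * h + 6 * x ^ 2 * (1 - x ^ 2) * p
      - 2 * x ^ 3 - 6 * ((1 - x ^ 2) ^ 2 * h - 2 * x * (1 - x ^ 2) * p + x ^ 2) *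
        ((1 - x ^ 2) * p - x) + 4 * ((1 - x ^ 2) * p - x) ^ 3 =
      (1 - x ^ 2) ^ 3 * (w - 6 * h * p + 4 * p ^ 3) := by ring
  have e3 : √((1 - x ^ 2) ^ 2 * (h - p ^ 2)) = (1 - x ^ 2) * √(h - p ^ 2) := by
    rw [Real.sqrt_mul (sq_nonneg _), Real.sqrt_sq hD.le]
  simp only [Pset, mem_ofPred_eq, e1, e2, e3]
  rcases le_or_gt (h - p ^ 2) 0 with hH | hH
  · refine iff_of_false (fun hP => ?_) (fun hP => hH.not_gt hP.1)
    rw [Real.sqrt_eq_zero_of_nonpos hH] at hP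
    linarith [hP.2.1, hP.2.2.2.1]
  have e4 : ((1 - x ^ 2) ^ 2 * (h - p ^ 2)) ^ ((3 : ℝ) / 2) =
      (1 - x ^ 2) ^ 3 * (h - p ^ 2) ^ ((3 : ℝ) / 2) := by
    rw [Real.mul_rpow (sq_nonneg _) hH.le, ← Real.rpow_natCast_mul hD.le]
    norm_num
  rw [e4, abs_mul, abs_of_pos (pow_pos hD 3), iff_true_intro hH, true_and]
  have key : ∀ {u a b c d : ℝ}, 0 < u → b - a = u * (d - c) → (a ≤ b ↔ c ≤ d) := by
    intro u a b c d hu h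
    rw [← sub_nonneg, h, mul_nonneg_iff_of_pos_left hu, sub_nonneg]
  refine and_congr (key hm1 (by ring)) (and_congr (key hm1 (by ring)) (and_congr
    (key hp1 (by ring)) (and_congr (key hp1 (by ring)) (key (pow_pos hD 3) (by ring)))))

/-- Along a positive solution of `p' = s² + p²`, `|s' - 2ps| ≤ ((k² - 1) / k) s²`, the quantity
`s / k + p` is a supersolution and `k s + p` a subsolution of `y' = y²`; this bounds them near `1`. -/
lemma riccati_bounds {f p s s' : ℝ → ℝ} {k : ℝ} (hk : 0 < k)
    (hf : ∀ x ∈ Ioo (-1 : ℝ) 1, HasDerivAt f (p x) x)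
    (hp : ∀ x ∈ Ioo (-1 : ℝ) 1, HasDerivAt p (s x ^ 2 + p x ^ 2) x)
    (hs : ∀ x ∈ Ioo (-1 : ℝ) 1, HasDerivAt s (s' x) x)
    (hs0 : ∀ x ∈ Ioo (-1 : ℝ) 1, 0 ≤ s x)
    (hbound : ∀ x ∈ Ioo (-1 : ℝ) 1, |s' x - 2 * p x * s x| ≤ (k ^ 2 - 1) / k * s x ^ 2)
    (hlim : Tendsto f (𝓝[Ioo (-1) 1] 1) atTop) {x : ℝ} (hx : x ∈ Ioo (-1 : ℝ) 1) :
    (s x / k + p x) * (1 - x) ≤ 1 ∧ 1 ≤ (k * s x + p x) * (1 - x) := by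
  constructor
  · refine mul_one_sub_le_one_of_sq_le_deriv (c := fun x => s x / k + p x)
      (fun x hx => ((hs x hx).div_const k).fun_add (hp x hx)) (fun x hx => ?_) hx
    have h := div_le_div_of_nonneg_right (neg_le_of_abs_le (hbound x hx)) hk.le
    have e : s' x / k + (s x ^ 2 + p x ^ 2) - (s x / k + p x) ^ 2 =
        (s' x - 2 * p x * s x) / k - -((k ^ 2 - 1) / k * s x ^ 2) / k := by
      field_simp
      ring
    linarith
  · refine one_le_mul_one_sub_of_deriv_le_sq (d := fun x => k * s x + p x) hf
      (fun x hx => ((hs x hx).const_mul k).fun_add (hp x hx)) (fun x hx => ?_) (fun x hx => ?_)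
      hlim hx
    · have h := mul_le_mul_of_nonneg_left (le_of_abs_le (hbound x hx)) hk.le
      have e : k * s' x + (s x ^ 2 + p x ^ 2) - (k * s x + p x) ^ 2 =
          k * (s' x - 2 * p x * s x) - k * ((k ^ 2 - 1) / k * s x ^ 2) := by
        field_simp
        ring
      linarith
    · have := mul_nonneg hk.le (hs0 x hx)
      linarith

lemma div_one_sub_sub_one_le {k s p x : ℝ} (hk : 0 < k) (hx : x ∈ Ico (0 : ℝ) 1)
    (h₁ : (s / k - p) * (1 + x) ≤ 1) (h₂ : 1 ≤ (k * s + p) * (1 - x)) :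
    1 / (k ^ 2 + 1) / (1 - x) - 1 ≤ p := by
  have hx' : 0 < 1 - x := by linarith [hx.2]
  have h3 : s / k ≤ 1 + p := by
    by_contra! h
    nlinarith [hx.1]
  rw [div_le_iff₀ hk] at h3
  have h4 : k * s + p ≤ (k ^ 2 + 1) * (p + 1) := by nlinarith
  have h5 : 1 / (k ^ 2 + 1) / (1 - x) ≤ p + 1 := by
    rw [div_div, div_le_iff₀ (by positivity)]
    nlinarith
  linarith

/-- A C³ function f on (−1,1) satisfies the ν-barrier conditions on [−1,1]
(f'' − f'² > 0, blow-up at ±1, and |f''' − 6f''f' + 4f'³| ≤ 2γ(f''−f'²)^{3/2} with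
γ = (ν−2)/√(ν−1)) if and only if at every x ∈ (−1,1) the centered triple (p̃,h̃,w̃)
belongs to the body P_ν. -/
theorem stmt_9 (ν : ℝ) (hν : 2 ≤ ν) (f : ℝ → ℝ)
    (hf : ContDiffOn ℝ 3 f (Set.Ioo (-1 : ℝ) 1)) :
    ((∀ x ∈ Set.Ioo (-1 : ℝ) 1, 0 < iteratedDeriv 2 f x - (deriv f x) ^ 2) ∧
      Tendsto f (nhdsWithin 1 (Set.Ioo (-1 : ℝ) 1)) atTop ∧
      Tendsto f (nhdsWithin (-1) (Set.Ioo (-1 : ℝ) 1)) atTop ∧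
      (∀ x ∈ Set.Ioo (-1 : ℝ) 1,
        |iteratedDeriv 3 f x - 6 * iteratedDeriv 2 f x * deriv f x + 4 * (deriv f x) ^ 3| ≤
          2 * ((ν - 2) / Real.sqrt (ν - 1)) *
            (iteratedDeriv 2 f x - (deriv f x) ^ 2) ^ ((3 : ℝ) / 2))) ↔
    (∀ x ∈ Set.Ioo (-1 : ℝ) 1,
      ((1 - x ^ 2) * deriv f x - x,
        (1 - x ^ 2) ^ 2 * iteratedDeriv 2 f x - 2 * x * (1 - x ^ 2) * deriv f x + x ^ 2,
        (1 - x ^ 2) ^ 3 * iteratedDeriv 3 f x - 6 * x * (1 - x ^ 2) ^ 2 * iteratedDeriv 2 f x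
          + 6 * x ^ 2 * (1 - x ^ 2) * deriv f x - 2 * x ^ 3) ∈ Pset ν) := by
  rw [forall₂_congr fun (x : ℝ) (hx : x ∈ Ioo (-1 : ℝ) 1) => centered_mem_Pset_iff (ν := ν)
    (p := deriv f x) (h := iteratedDeriv 2 f x) (w := iteratedDeriv 3 f x) hx]
  set p := deriv f
  set h := iteratedDeriv 2 f
  set w := iteratedDeriv 3 f
  have hk : 0 < √(ν - 1) := Real.sqrt_pos.2 (by linarith)
  have hk2 : √(ν - 1) ^ 2 = ν - 1 := Real.sq_sqrt (by linarith)
  set k := √(ν - 1)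
  have hγ : ν - 2 = k ^ 2 - 1 := by linarith
  have hf0 : ∀ x ∈ Ioo (-1 : ℝ) 1, HasDerivAt f (p x) x := fun x hx => by
    simpa only [zero_add, iteratedDeriv_zero, iteratedDeriv_one] using
      hasDerivAt_iteratedDeriv_of_contDiffOn isOpen_Ioo hf (k := 0) (by norm_num) hx
  have hp : ∀ x ∈ Ioo (-1 : ℝ) 1, HasDerivAt p (h x) x := fun x hx => by
    simpa [iteratedDeriv_one] using
      hasDerivAt_iteratedDeriv_of_contDiffOn isOpen_Ioo hf (k := 1) (by norm_num) hx
  have hh : ∀ x ∈ Ioo (-1 : ℝ) 1, HasDerivAt h (w x) x := fun x hx =>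
    hasDerivAt_iteratedDeriv_of_contDiffOn isOpen_Ioo hf (k := 2) (by norm_num) hx
  have hnf := hasDerivAt_comp_neg hf0
  constructor
  · rintro ⟨hpos, hlim1, hlim2, hbound⟩
    set s : ℝ → ℝ := fun x => √(h x - p x ^ 2) with hs_def
    set s' : ℝ → ℝ := fun x => (w x - 2 * p x * h x) / (2 * s x)
    have hs0 : ∀ x ∈ Ioo (-1 : ℝ) 1, 0 < s x := fun x hx => Real.sqrt_pos.2 (hpos x hx)
    have hs2 : ∀ x ∈ Ioo (-1 : ℝ) 1, h x = s x ^ 2 + p x ^ 2 := fun x hx => by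
      rw [hs_def, Real.sq_sqrt (hpos x hx).le]
      ring
    have hs : ∀ x ∈ Ioo (-1 : ℝ) 1, HasDerivAt s (s' x) x := fun x hx =>
      (((hh x hx).fun_sub ((hp x hx).fun_pow 2)).sqrt (hpos x hx).ne').congr_deriv (by simp [s', s])
    have hp' : ∀ x ∈ Ioo (-1 : ℝ) 1, HasDerivAt p (s x ^ 2 + p x ^ 2) x := fun x hx =>
      hs2 x hx ▸ hp x hx
    have hsb : ∀ x ∈ Ioo (-1 : ℝ) 1,
        |s' x - 2 * p x * s x| ≤ (k ^ 2 - 1) / k * s x ^ 2 := fun x hx => by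
      have hsx := hs0 x hx
      have h1 := hbound x hx
      have e1 : (h x - p x ^ 2) ^ ((3 : ℝ) / 2) = s x ^ 3 := by
        rw [Real.rpow_div_two_eq_sqrt _ (hpos x hx).le]
        norm_cast
      have e2 : w x - 6 * h x * p x + 4 * p x ^ 3 = 2 * s x * (s' x - 2 * p x * s x) := by
        simp only [s', hs2 x hx]
        field_simp
        ring
      rw [e1, e2, abs_mul, abs_of_pos (by positivity : 0 < 2 * s x), hγ] at h1
      refine le_of_mul_le_mul_left (h1.trans_eq ?_) (by positivity : 0 < 2 * s x)
      ring
    have hnlim : Tendsto (fun x => f (-x)) (𝓝[Ioo (-1) 1] 1) atTop :=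
      hlim2.comp (tendsto_neg_nhdsWithin_Ioo 1)
    intro x hx
    obtain ⟨h3, h4⟩ := riccati_bounds hk hf0 hp' hs (fun x hx => (hs0 x hx).le) hsb hlim1 hx
    obtain ⟨h1, h2⟩ := riccati_bounds (p := fun x => -p (-x)) (s := fun x => s (-x))
      (s' := fun x => -s' (-x)) hk hnf
      (fun x hx => ((hasDerivAt_comp_neg hp' x hx).fun_neg).congr_deriv (by ring))
      (hasDerivAt_comp_neg hs) (fun x hx => (hs0 _ (neg_mem_Ioo_neg_one_one hx)).le)
      (fun x hx => by
        have := hsb _ (neg_mem_Ioo_neg_one_one hx)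
        rw [← abs_neg] at this
        convert this using 2
        ring) hnlim (neg_mem_Ioo_neg_one_one hx)
    simp only [neg_neg, sub_neg_eq_add, ← sub_eq_add_neg] at h1 h2
    exact ⟨hpos x hx, h1, h2, h3, h4, hbound x hx⟩
  · intro H
    have ha : 0 < 1 / (k ^ 2 + 1) := by positivity
    refine ⟨fun x hx => (H x hx).1, ?_, ?_, fun x hx => (H x hx).2.2.2.2.2⟩
    · refine tendsto_atTop_of_div_one_sub_le_deriv ha zero_le_one hf0 fun x hx => ?_
      obtain ⟨-, h1, -, -, h4, -⟩ := H x ⟨by linarith [hx.1], hx.2⟩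
      exact div_one_sub_sub_one_le hk hx h1 h4
    · have hn : Tendsto (fun x => f (-x)) (𝓝[Ioo (-1) 1] 1) atTop := by
        refine tendsto_atTop_of_div_one_sub_le_deriv ha zero_le_one hnf fun x hx => ?_
        obtain ⟨-, -, h2, h3, -, -⟩ := H (-x) (neg_mem_Ioo_neg_one_one ⟨by linarith [hx.1], hx.2⟩)
        exact div_one_sub_sub_one_le hk hx (by simpa using h3) (by simpa [sub_eq_add_neg] using h2)
      have := tendsto_neg_nhdsWithin_Ioo (-1)
      rw [neg_neg] at this
      simpa [Function.comp_def] using hn.comp this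
end

section
/- Let ν ≥ 2 and let C ⊂ ℝⁿ be a compact convex set with interior C°. A C² function f : C° → ℝ is ν-admissible if and only if for every interval I ⊂ C° linking two boundary points of C (i.e., I is the intersection of C° with a line meeting ∂C at two points), the restriction of f to I (affinely parameterized over (−1,1)) is ν-admissible as a function of one variable. -/
open Filter
/-- ζ₊(x,u) for a 1-dimensional function: 6h p − 4p³ + 2γ(h − p²)^{3/2}. -/
noncomputable def zetaPlus (γ p h : ℝ) : ℝ :=
  6 * h * p - 4 * p ^ 3 + 2 * γ * (h - p ^ 2) ^ ((3 : ℝ) / 2)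

/-- ζ₋(x,u) for a 1-dimensional function: 6h p − 4p³ − 2γ(h − p²)^{3/2}. -/
noncomputable def zetaMinus (γ p h : ℝ) : ℝ :=
  6 * h * p - 4 * p ^ 3 - 2 * γ * (h - p ^ 2) ^ ((3 : ℝ) / 2)

/-- A C² function f on (−1,1) is ν-admissible on C = [−1,1]: f'' − f'² > 0, f blows up at
both endpoints, and the second derivative satisfies the one-sided Lipschitz-type bounds
ζ₋ ≤ liminf/limsup of its difference quotients ≤ ζ₊, where γ = (ν−2)/√(ν−1). -/
noncomputable def Admissible1D (ν : ℝ) (f : ℝ → ℝ) : Prop :=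
  ContDiffOn ℝ 2 f (Set.Ioo (-1 : ℝ) 1) ∧
  (∀ x ∈ Set.Ioo (-1 : ℝ) 1, 0 < deriv (deriv f) x - (deriv f x) ^ 2) ∧
  Filter.Tendsto f (nhdsWithin 1 (Set.Ioo (-1 : ℝ) 1)) Filter.atTop ∧
  Filter.Tendsto f (nhdsWithin (-1) (Set.Ioo (-1 : ℝ) 1)) Filter.atTop ∧
  (∀ x ∈ Set.Ioo (-1 : ℝ) 1,
    Filter.limsup (fun ε => (deriv (deriv f) (x + ε) - deriv (deriv f) x) / ε)
        (nhdsWithin (0 : ℝ) {(0 : ℝ)}ᶜ)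
      ≤ zetaPlus ((ν - 2) / Real.sqrt (ν - 1)) (deriv f x) (deriv (deriv f) x) ∧
    zetaMinus ((ν - 2) / Real.sqrt (ν - 1)) (deriv f x) (deriv (deriv f) x)
      ≤ Filter.liminf (fun ε => (deriv (deriv f) (x + ε) - deriv (deriv f) x) / ε)
        (nhdsWithin (0 : ℝ) {(0 : ℝ)}ᶜ))

/-- A C² function f on the interior of a compact convex set C ⊂ ℝⁿ is ν-admissible:
f''−f'⊗f' positive definite, blow-up at the boundary, and the one-sided Lipschitz-type
bounds ζ₋ ≤ liminf/limsup of the difference quotients of f''[u,u] ≤ ζ₊ in every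
direction u, where γ = (ν−2)/√(ν−1). -/
noncomputable def AdmissibleOn {n : ℕ} (ν : ℝ) (C : Set (EuclideanSpace ℝ (Fin n)))
    (f : EuclideanSpace ℝ (Fin n) → ℝ) : Prop :=
  ContDiffOn ℝ 2 f (interior C) ∧
  (∀ x ∈ interior C, ∀ u : EuclideanSpace ℝ (Fin n), u ≠ 0 →
    0 < iteratedFDeriv ℝ 2 f x (fun _ => u) - (fderiv ℝ f x u) ^ 2) ∧
  (∀ y ∈ frontier C, Tendsto f (nhdsWithin y (interior C)) atTop) ∧
  (∀ x ∈ interior C, ∀ u : EuclideanSpace ℝ (Fin n),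
    Filter.limsup (fun ε : ℝ =>
        (iteratedFDeriv ℝ 2 f (x + ε • u) (fun _ => u)
          - iteratedFDeriv ℝ 2 f x (fun _ => u)) / ε)
        (nhdsWithin (0 : ℝ) {(0 : ℝ)}ᶜ)
      ≤ zetaPlus ((ν - 2) / Real.sqrt (ν - 1)) (fderiv ℝ f x u)
          (iteratedFDeriv ℝ 2 f x (fun _ => u)) ∧
    zetaMinus ((ν - 2) / Real.sqrt (ν - 1)) (fderiv ℝ f x u)
        (iteratedFDeriv ℝ 2 f x (fun _ => u))
      ≤ Filter.liminf (fun ε : ℝ =>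
        (iteratedFDeriv ℝ 2 f (x + ε • u) (fun _ => u)
          - iteratedFDeriv ℝ 2 f x (fun _ => u)) / ε)
        (nhdsWithin (0 : ℝ) {(0 : ℝ)}ᶜ))

open Set Topology

section Limsup

theorem Real.limsup_const_mul {α : Type*} (l : Filter α) (q : α → ℝ) {c : ℝ} (hc : 0 < c) :
    limsup (fun x => c * q x) l = c * limsup q l := by
  rw [limsup_eq, limsup_eq, ← smul_eq_mul, ← Real.sInf_smul_of_nonneg hc.le]
  congr 1
  ext a
  rw [Set.mem_smul_set_iff_inv_smul_mem₀ hc.ne']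
  simp only [mem_ofPred_eq, smul_eq_mul, inv_mul_eq_div, le_div_iff₀ hc, mul_comm c]

theorem Real.liminf_const_mul {α : Type*} (l : Filter α) (q : α → ℝ) {c : ℝ} (hc : 0 < c) :
    liminf (fun x => c * q x) l = c * liminf q l := by
  rw [liminf_eq, liminf_eq, ← smul_eq_mul, ← Real.sSup_smul_of_nonneg hc.le]
  congr 1
  ext a
  rw [Set.mem_smul_set_iff_inv_smul_mem₀ hc.ne']
  simp only [mem_ofPred_eq, smul_eq_mul, inv_mul_eq_div, div_le_iff₀ hc, mul_comm c]

theorem map_const_mul_nhdsNE_zero {c : ℝ} (hc : c ≠ 0) :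
    Filter.map (fun x : ℝ => c * x) (𝓝[≠] 0) = 𝓝[≠] 0 := by
  have h := (Homeomorph.mulLeft₀ c hc).map_punctured_nhds_eq 0
  simpa using h

end Limsup

section Homogeneity

theorem mul_sq_rpow_three_halves {c d : ℝ} (hc : 0 ≤ c) (hd : 0 ≤ d) :
    (c ^ 2 * d) ^ ((3 : ℝ) / 2) = c ^ 3 * d ^ ((3 : ℝ) / 2) := by
  rw [Real.mul_rpow (by positivity) hd, ← Real.rpow_natCast c 2, ← Real.rpow_mul hc,
    ← Real.rpow_natCast c 3]
  norm_num

theorem zetaPlus_scale (γ p h : ℝ) {c : ℝ} (hc : 0 ≤ c) (hh : 0 ≤ h - p ^ 2) :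
    zetaPlus γ (c * p) (c ^ 2 * h) = c ^ 3 * zetaPlus γ p h := by
  unfold zetaPlus
  rw [show c ^ 2 * h - (c * p) ^ 2 = c ^ 2 * (h - p ^ 2) by ring, mul_sq_rpow_three_halves hc hh]
  ring

theorem zetaMinus_scale (γ p h : ℝ) {c : ℝ} (hc : 0 ≤ c) (hh : 0 ≤ h - p ^ 2) :
    zetaMinus γ (c * p) (c ^ 2 * h) = c ^ 3 * zetaMinus γ p h := by
  unfold zetaMinus
  rw [show c ^ 2 * h - (c * p) ^ 2 = c ^ 2 * (h - p ^ 2) by ring, mul_sq_rpow_three_halves hc hh]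
  ring

end Homogeneity

section Chords

variable {E : Type*} [NormedAddCommGroup E] [NormedSpace ℝ E]

theorem exists_pos_smul_add_mem_frontier {C : Set E} (hC : IsCompact C) {x u : E}
    (hx : x ∈ interior C) (hu : u ≠ 0) : ∃ r : ℝ, 0 < r ∧ x + r • u ∈ frontier C := by
  have hcont : Continuous fun r : ℝ => x + r • u := by fun_prop
  have hpre : IsPreconnected ((fun r : ℝ => x + r • u) '' Ici 0) :=
    isPreconnected_Ici.image _ hcont.continuousOn
  obtain ⟨R, hR⟩ := hC.isBounded.subset_closedBall x
  have hu' : 0 < ‖u‖ := norm_pos_iff.mpr hu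
  have hout : ∃ r : ℝ, 0 ≤ r ∧ x + r • u ∉ C := by
    refine ⟨(|R| + 1) / ‖u‖, by positivity, fun h => ?_⟩
    have h' := hR h
    rw [Metric.mem_closedBall, dist_eq_norm, add_sub_cancel_left, norm_smul, Real.norm_eq_abs,
      abs_of_nonneg (by positivity), div_mul_cancel₀ _ hu'.ne'] at h'
    linarith [le_abs_self R]
  obtain ⟨r₀, hr₀, hr₀C⟩ := hout
  obtain ⟨r, hr, hz⟩ : ∃ r : ℝ, 0 ≤ r ∧ x + r • u ∈ frontier C := by
    by_contra! hno
    obtain ⟨z, -, hzi, hzo⟩ := hpre (interior C) Cᶜ isOpen_interior hC.isClosed.isOpen_compl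
      (by
        rintro _ ⟨r, hr, rfl⟩
        by_cases h : x + r • u ∈ C
        · exact Or.inl (by_contra fun h' => hno r hr ⟨subset_closure h, h'⟩)
        · exact Or.inr h)
      ⟨x, ⟨0, self_mem_Ici, by simp⟩, hx⟩ ⟨_, ⟨r₀, hr₀, rfl⟩, hr₀C⟩
    exact hzo (interior_subset hzi)
  refine ⟨r, lt_of_le_of_ne hr ?_, hz⟩
  rintro rfl
  simp only [zero_smul, add_zero] at hz
  exact hz.2 hx

/-- The affine parametrization of the segment from `a` to `b` by `[-1, 1]`. -/
noncomputable def chord (a b : E) (t : ℝ) : E := (1 / 2 : ℝ) • (a + b) + (t / 2) • (b - a)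

theorem chord_eq_combo (a b : E) (t : ℝ) :
    chord a b t = ((1 - t) / 2) • a + ((1 + t) / 2) • b := by
  unfold chord; module

@[simp] theorem chord_one (a b : E) : chord a b 1 = b := by
  unfold chord; module

@[simp] theorem chord_neg_one (a b : E) : chord a b (-1) = a := by
  unfold chord; module

theorem chord_add (a b : E) (t ε : ℝ) :
    chord a b (t + ε) = chord a b t + ε • ((1 / 2 : ℝ) • (b - a)) := by
  unfold chord; module

theorem chord_combo (a b : E) (s t p q : ℝ) (h : p + q = 1) :
    p • chord a b s + q • chord a b t = chord a b (p * s + q * t) := by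
  obtain rfl : p = 1 - q := by linarith
  unfold chord; module

theorem continuous_chord (a b : E) : Continuous (chord a b) := by
  unfold chord; fun_prop

theorem contDiff_chord (a b : E) : ContDiff ℝ 2 (chord a b) := by
  unfold chord; fun_prop

theorem hasDerivAt_chord (a b : E) (t : ℝ) :
    HasDerivAt (chord a b) ((1 / 2 : ℝ) • (b - a)) t := by
  unfold chord
  exact (((hasDerivAt_id t).div_const 2).smul_const (b - a)).const_add _

theorem chord_mem {C : Set E} {a b : E} (h : openSegment ℝ a b ⊆ C) {t : ℝ}
    (ht : t ∈ Ioo (-1 : ℝ) 1) : chord a b t ∈ C := by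
  refine h ⟨(1 - t) / 2, (1 + t) / 2, ?_, ?_, ?_, (chord_eq_combo a b t).symm⟩
  · linarith [ht.2]
  · linarith [ht.1]
  · ring

/-- A segment between two points of a convex set that meets the interior has its relative interior
in the interior. -/
theorem openSegment_subset_interior_of_mem {C : Set E} (hconv : Convex ℝ C)
    {x u : E} (hx : x ∈ interior C) {r s : ℝ} (hr : 0 < r) (hs : 0 < s) (ha : x + s • -u ∈ C)
    (hb : x + r • u ∈ C) : openSegment ℝ (x + s • -u) (x + r • u) ⊆ interior C := by
  have hmem : ∀ (w : E), w ∈ C → ∀ p q : ℝ, 0 < p → 0 ≤ q → p + q = 1 →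
      p • x + q • w ∈ interior C := fun w hw p q hp hq hpq =>
    hconv.combo_interior_self_mem_interior hx hw hp hq hpq
  rintro _ ⟨p, q, hp, hq, hpq, rfl⟩
  obtain rfl : p = 1 - q := by linarith
  rcases le_total ((1 - q) * s) (q * r) with h | h
  · convert hmem _ hb (1 - (q * r - (1 - q) * s) / r) ((q * r - (1 - q) * s) / r) ?_
      (div_nonneg (by linarith) hr.le) (by ring) using 1
    · match_scalars <;> field_simp <;> ring
    · rw [sub_pos, div_lt_one hr]; nlinarith
  · convert hmem _ ha (1 - ((1 - q) * s - q * r) / s) (((1 - q) * s - q * r) / s) ?_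
      (div_nonneg (by linarith) hs.le) (by ring) using 1
    · match_scalars <;> field_simp <;> ring
    · rw [sub_pos, div_lt_one hs]; nlinarith

theorem exists_chord {C : Set E} (hC : IsCompact C) (hconv : Convex ℝ C) {x u : E}
    (hx : x ∈ interior C) (hu : u ≠ 0) :
    ∃ a ∈ frontier C, ∃ b ∈ frontier C, openSegment ℝ a b ⊆ interior C ∧
      ∃ t ∈ Ioo (-1 : ℝ) 1, chord a b t = x ∧
      ∃ c : ℝ, 0 < c ∧ (1 / 2 : ℝ) • (b - a) = c • u := by
  obtain ⟨r, hr, hb⟩ := exists_pos_smul_add_mem_frontier hC hx hu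
  obtain ⟨s, hs, ha⟩ := exists_pos_smul_add_mem_frontier hC hx (neg_ne_zero.mpr hu)
  refine ⟨_, ha, _, hb, ?_, (s - r) / (s + r), ⟨?_, ?_⟩, ?_, (s + r) / 2, by positivity, ?_⟩
  · exact openSegment_subset_interior_of_mem hconv hx hr hs (hC.isClosed.frontier_subset ha)
      (hC.isClosed.frontier_subset hb)
  · rw [lt_div_iff₀ (by positivity)]; linarith
  · rw [div_lt_one (by positivity)]; linarith
  · unfold chord
    match_scalars <;> field_simp <;> ring
  · module

theorem tendsto_chord_nhdsWithin {C : Set E} {a b : E} (h : openSegment ℝ a b ⊆ C) (t : ℝ) :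
    Tendsto (chord a b) (𝓝[Ioo (-1) 1] t) (𝓝[C] (chord a b t)) :=
  tendsto_nhdsWithin_of_tendsto_nhds_of_eventually_within _
    ((continuous_chord a b).continuousAt.mono_left nhdsWithin_le_nhds)
    (eventually_nhdsWithin_of_forall fun _ hs => chord_mem h hs)

theorem deriv_comp_chord {U : Set E} (hU : IsOpen U) {f : E → ℝ} (hf : ContDiffOn ℝ 2 f U)
    {a b : E} {t : ℝ} (ht : chord a b t ∈ U) :
    deriv (fun s => f (chord a b s)) t = fderiv ℝ f (chord a b t) ((1 / 2 : ℝ) • (b - a)) := by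
  have hd : DifferentiableAt ℝ f (chord a b t) :=
    (hf.contDiffAt (hU.mem_nhds ht)).differentiableAt (by norm_num)
  exact (hd.hasFDerivAt.comp_hasDerivAt t (hasDerivAt_chord a b t)).deriv

theorem deriv_deriv_comp_chord {U : Set E} (hU : IsOpen U) {f : E → ℝ}
    (hf : ContDiffOn ℝ 2 f U) {a b : E} {t : ℝ} (ht : chord a b t ∈ U) :
    deriv (deriv fun s => f (chord a b s)) t =
      iteratedFDeriv ℝ 2 f (chord a b t) fun _ => (1 / 2 : ℝ) • (b - a) := by
  have hev : (deriv fun s => f (chord a b s)) =ᶠ[𝓝 t]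
      fun s => fderiv ℝ f (chord a b s) ((1 / 2 : ℝ) • (b - a)) := by
    filter_upwards [(hU.preimage (continuous_chord a b)).mem_nhds ht] with s hs
    exact deriv_comp_chord hU hf hs
  have hd : DifferentiableAt ℝ (fderiv ℝ f) (chord a b t) :=
    ((hf.contDiffAt (hU.mem_nhds ht)).fderiv_right (m := 1) (by norm_num)).differentiableAt
      (by norm_num)
  rw [hev.deriv_eq, iteratedFDeriv_two_apply]
  exact ((hd.hasFDerivAt.comp_hasDerivAt t (hasDerivAt_chord a b t)).clm_apply
    (hasDerivAt_const t _)).deriv.trans (by simp)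

theorem differenceQuotient_comp_chord {U : Set E} (hU : IsOpen U) {f : E → ℝ}
    (hf : ContDiffOn ℝ 2 f U) {a b : E} {t : ℝ} (ht : chord a b t ∈ U) :
    (fun ε => (deriv (deriv fun s => f (chord a b s)) (t + ε) -
        deriv (deriv fun s => f (chord a b s)) t) / ε) =ᶠ[𝓝[≠] 0]
      fun ε : ℝ =>
        (iteratedFDeriv ℝ 2 f (chord a b t + ε • ((1 / 2 : ℝ) • (b - a)))
            (fun _ => (1 / 2 : ℝ) • (b - a)) -
          iteratedFDeriv ℝ 2 f (chord a b t) (fun _ => (1 / 2 : ℝ) • (b - a))) / ε := by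
  have hopen : IsOpen ((fun ε => chord a b (t + ε)) ⁻¹' U) :=
    hU.preimage ((continuous_chord a b).comp (by fun_prop))
  filter_upwards [nhdsWithin_le_nhds (hopen.mem_nhds (x := 0) (by simpa using ht))] with ε hε
  rw [deriv_deriv_comp_chord hU hf hε, deriv_deriv_comp_chord hU hf ht, chord_add]

theorem iteratedFDeriv_two_smul (f : E → ℝ) (x u : E) (c : ℝ) :
    iteratedFDeriv ℝ 2 f x (fun _ => c • u) = c ^ 2 * iteratedFDeriv ℝ 2 f x (fun _ => u) := by
  simp only [iteratedFDeriv_two_apply, map_smul, _root_.smul_apply, smul_eq_mul]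
  ring

theorem differenceQuotient_smul (f : E → ℝ) (x u : E) {c : ℝ} (hc : c ≠ 0) :
    (fun ε : ℝ => (iteratedFDeriv ℝ 2 f (x + ε • c • u) (fun _ => c • u) -
        iteratedFDeriv ℝ 2 f x (fun _ => c • u)) / ε) =
      fun ε : ℝ => c ^ 3 * ((fun δ : ℝ => (iteratedFDeriv ℝ 2 f (x + δ • u) (fun _ => u) -
        iteratedFDeriv ℝ 2 f x (fun _ => u)) / δ) ∘ fun ε => c * ε) ε := by
  ext ε
  simp only [iteratedFDeriv_two_smul, Function.comp_apply, smul_smul, mul_comm ε c]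
  rcases eq_or_ne ε 0 with rfl | hε
  · simp
  · field_simp

theorem limsup_differenceQuotient_smul (f : E → ℝ) (x u : E) {c : ℝ} (hc : 0 < c) :
    limsup (fun ε : ℝ => (iteratedFDeriv ℝ 2 f (x + ε • c • u) (fun _ => c • u) -
        iteratedFDeriv ℝ 2 f x (fun _ => c • u)) / ε) (𝓝[≠] 0) =
      c ^ 3 * limsup (fun ε : ℝ => (iteratedFDeriv ℝ 2 f (x + ε • u) (fun _ => u) -
        iteratedFDeriv ℝ 2 f x (fun _ => u)) / ε) (𝓝[≠] 0) := by
  rw [differenceQuotient_smul f x u hc.ne', Real.limsup_const_mul _ _ (pow_pos hc 3), limsup_comp,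
    map_const_mul_nhdsNE_zero hc.ne']

theorem liminf_differenceQuotient_smul (f : E → ℝ) (x u : E) {c : ℝ} (hc : 0 < c) :
    liminf (fun ε : ℝ => (iteratedFDeriv ℝ 2 f (x + ε • c • u) (fun _ => c • u) -
        iteratedFDeriv ℝ 2 f x (fun _ => c • u)) / ε) (𝓝[≠] 0) =
      c ^ 3 * liminf (fun ε : ℝ => (iteratedFDeriv ℝ 2 f (x + ε • u) (fun _ => u) -
        iteratedFDeriv ℝ 2 f x (fun _ => u)) / ε) (𝓝[≠] 0) := by
  rw [differenceQuotient_smul f x u hc.ne', Real.liminf_const_mul _ _ (pow_pos hc 3), liminf_comp,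
    map_const_mul_nhdsNE_zero hc.ne']

/-- A quasiconvex function on the interior of a convex body that blows up at both ends of every
chord blows up at the boundary. -/
theorem tendsto_atTop_frontier_of_chords {C : Set E} (hC : IsCompact C) (hconv : Convex ℝ C)
    {f : E → ℝ} (hf : ContinuousOn f (interior C)) (hqc : QuasiconvexOn ℝ (interior C) f)
    (hblow : ∀ a ∈ frontier C, ∀ b ∈ frontier C, openSegment ℝ a b ⊆ interior C →
      Tendsto (fun t => f (chord a b t)) (𝓝[Ioo (-1) 1] 1) atTop)
    {y : E} (hy : y ∈ frontier C) : Tendsto f (𝓝[interior C] y) atTop := by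
  rcases (interior C).eq_empty_or_nonempty with he | ⟨x₀, hx₀⟩
  · simp [he]
  by_contra hnot
  rw [tendsto_atTop] at hnot
  push Not at hnot
  obtain ⟨M, hM⟩ := hnot
  have hM' : ∃ᶠ x in 𝓝[interior C] y, f x < M := by simpa using hM
  have hyC : y ∈ C := hC.isClosed.frontier_subset hy
  have hbound : ∀ p q : ℝ, 0 < p → 0 ≤ q → p + q = 1 → f (p • x₀ + q • y) ≤ max (f x₀) M := by
    intro p q hp hq hpq
    have hz : p • x₀ + q • y ∈ interior C :=
      hconv.combo_interior_self_mem_interior hx₀ hyC hp hq hpq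
    have hlim : Tendsto (fun x => f (p • x₀ + q • x)) (𝓝[interior C] y)
        (𝓝 (f (p • x₀ + q • y))) :=
      ((hf.continuousAt (isOpen_interior.mem_nhds hz)).tendsto.comp
        (Continuous.tendsto (by fun_prop : Continuous fun x => p • x₀ + q • x) y)).mono_left
        nhdsWithin_le_nhds
    refine le_of_tendsto_of_frequently hlim ?_
    refine (hM'.and_eventually self_mem_nhdsWithin).mono fun x ⟨hxM, hx⟩ => ?_
    exact (hqc (max (f x₀) M) ⟨hx₀, le_max_left _ _⟩ ⟨hx, hxM.le.trans (le_max_right _ _)⟩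
      hp.le hq hpq).2
  have hne : y - x₀ ≠ 0 := by
    rw [sub_ne_zero]; rintro rfl; exact hy.2 hx₀
  obtain ⟨r, hr, ha⟩ := exists_pos_smul_add_mem_frontier hC hx₀ (neg_ne_zero.mpr hne)
  set a := x₀ + r • -(y - x₀) with ha_def
  have hcombo : ∀ t : ℝ, chord a y t =
      ((1 - t) / 2 * (1 + r)) • x₀ + (1 - (1 - t) / 2 * (1 + r)) • y := by
    intro t; rw [chord_eq_combo, ha_def]; module
  have hseg : openSegment ℝ a y ⊆ interior C := by
    have h := openSegment_subset_interior_of_mem hconv hx₀ one_pos hr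
      (hC.isClosed.frontier_subset ha) (u := y - x₀) (by simpa using hyC)
    rwa [one_smul, add_sub_cancel] at h
  have hev := (hblow a ha y hy hseg).eventually_gt_atTop (max (f x₀) M)
  have hev2 : ∀ᶠ t : ℝ in 𝓝[Ioo (-1) 1] 1, 0 ≤ 1 - (1 - t) / 2 * (1 + r) := by
    have : Tendsto (fun t : ℝ => 1 - (1 - t) / 2 * (1 + r)) (𝓝[Ioo (-1) 1] 1) (𝓝 1) := by
      refine (Continuous.tendsto' (by fun_prop) _ _ (by norm_num)).mono_left nhdsWithin_le_nhds
    exact this.eventually_const_le one_pos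
  have : (𝓝[Ioo (-1 : ℝ) 1] 1).NeBot := right_nhdsWithin_Ioo_neBot (by norm_num)
  obtain ⟨t, h1, h2, h3⟩ := (hev.and (hev2.and self_mem_nhdsWithin)).exists
  rw [hcombo] at h1
  have := hbound ((1 - t) / 2 * (1 + r)) _
    (mul_pos (by linarith [h3.2]) (by linarith)) h2 (by ring)
  exact absurd h1 (not_lt.mpr this)

end Chords

section Admissible

variable {n : ℕ} {ν : ℝ} {C : Set (EuclideanSpace ℝ (Fin n))} {f : EuclideanSpace ℝ (Fin n) → ℝ}

theorem AdmissibleOn.admissible1D_chord (h : AdmissibleOn ν C f) {a b : EuclideanSpace ℝ (Fin n)}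
    (ha : a ∈ frontier C) (hb : b ∈ frontier C) (hab : openSegment ℝ a b ⊆ interior C) :
    Admissible1D ν fun t => f (chord a b t) := by
  obtain ⟨hf, hpos, hblow, hlim⟩ := h
  have hne : (1 / 2 : ℝ) • (b - a) ≠ 0 := by
    refine smul_ne_zero (by norm_num) (sub_ne_zero.mpr ?_)
    rintro rfl
    exact ha.2 (hab (by simp))
  refine ⟨hf.comp (contDiff_chord a b).contDiffOn fun t ht => chord_mem hab ht,
    fun t ht => ?_, ?_, ?_, fun t ht => ?_⟩
  · rw [deriv_deriv_comp_chord isOpen_interior hf (chord_mem hab ht),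
      deriv_comp_chord isOpen_interior hf (chord_mem hab ht)]
    exact hpos _ (chord_mem hab ht) _ hne
  · exact (hblow b hb).comp (by simpa using tendsto_chord_nhdsWithin hab 1)
  · exact (hblow a ha).comp (by simpa using tendsto_chord_nhdsWithin hab (-1))
  · rw [limsup_congr (differenceQuotient_comp_chord isOpen_interior hf (chord_mem hab ht)),
      liminf_congr (differenceQuotient_comp_chord isOpen_interior hf (chord_mem hab ht)),
      deriv_deriv_comp_chord isOpen_interior hf (chord_mem hab ht),
      deriv_comp_chord isOpen_interior hf (chord_mem hab ht)]
    exact hlim _ (chord_mem hab ht) _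

theorem Admissible1D.convexOn {g : ℝ → ℝ} (h : Admissible1D ν g) :
    ConvexOn ℝ (Ioo (-1) 1) g := by
  refine convexOn_of_deriv2_nonneg' (convex_Ioo _ _) (h.1.differentiableOn (by norm_num)) ?_
    fun x hx => ?_
  · exact (h.1.deriv_of_isOpen (m := 1) isOpen_Ioo (by norm_num)).differentiableOn (by norm_num)
  · simp only [Function.iterate_succ, Function.iterate_zero, Function.comp_apply, id]
    nlinarith [h.2.1 x hx, sq_nonneg (deriv g x)]

theorem quasiconvexOn_of_admissible1D_chords (hC : IsCompact C) (hconv : Convex ℝ C)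
    (h : ∀ a ∈ frontier C, ∀ b ∈ frontier C, openSegment ℝ a b ⊆ interior C →
      Admissible1D ν fun t => f (chord a b t)) : QuasiconvexOn ℝ (interior C) f := by
  refine (ConvexOn.quasiconvexOn ⟨hconv.interior, fun x hx z hz p q hp hq hpq => ?_⟩)
  rcases eq_or_ne z x with rfl | hzx
  · rw [Convex.combo_self hpq, Convex.combo_self hpq]
  obtain ⟨a, ha, b, hb, hab, t, ht, rfl, c, hc, hcu⟩ :=
    exists_chord hC hconv hx (sub_ne_zero.mpr hzx)
  have hz' : chord a b (t + 1 / c) = z := by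
    rw [chord_add, hcu, smul_smul, one_div_mul_cancel hc.ne', one_smul, add_sub_cancel]
  have htz : t + 1 / c ∈ Ioo (-1 : ℝ) 1 := by
    refine ⟨by linarith [ht.1, one_div_pos.mpr hc], ?_⟩
    by_contra! hge
    have hb_mem : b ∈ interior C := by
      have hpos : 0 < 1 - t := by linarith [ht.2]
      have hle : (1 - t) * c ≤ 1 := by
        rw [← le_div_iff₀ hc]; linarith
      have := hconv.interior hx hz (sub_nonneg.mpr hle) (mul_pos hpos hc).le (by ring)
      rw [← hz', chord_combo _ _ _ _ _ _ (by ring)] at this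
      convert this
      rw [show (1 - (1 - t) * c) * t + (1 - t) * c * (t + 1 / c) = 1 by field_simp; ring, chord_one]
    exact hb.2 hb_mem
  have := (h a ha b hb hab).convexOn.2 ht htz hp hq hpq
  rw [← hz', chord_combo _ _ _ _ _ _ hpq]
  exact this

theorem admissibleOn_of_admissible1D_chords (hC : IsCompact C) (hconv : Convex ℝ C)
    (hf : ContDiffOn ℝ 2 f (interior C))
    (h : ∀ a ∈ frontier C, ∀ b ∈ frontier C, openSegment ℝ a b ⊆ interior C →
      Admissible1D ν fun t => f (chord a b t)) : AdmissibleOn ν C f := by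
  have hpos : ∀ x ∈ interior C, ∀ u : EuclideanSpace ℝ (Fin n), u ≠ 0 →
      0 < iteratedFDeriv ℝ 2 f x (fun _ => u) - (fderiv ℝ f x u) ^ 2 := by
    intro x hx u hu
    obtain ⟨a, ha, b, hb, hab, t, ht, rfl, c, hc, hcu⟩ := exists_chord hC hconv hx hu
    have h2 := (h a ha b hb hab).2.1 t ht
    rw [deriv_deriv_comp_chord isOpen_interior hf hx, deriv_comp_chord isOpen_interior hf hx,
      hcu, iteratedFDeriv_two_smul, map_smul, smul_eq_mul, mul_pow, ← mul_sub] at h2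
    exact pos_of_mul_pos_right h2 (by positivity)
  refine ⟨hf, hpos, fun y hy => ?_, fun x hx u => ?_⟩
  · exact tendsto_atTop_frontier_of_chords hC hconv hf.continuousOn
      (quasiconvexOn_of_admissible1D_chords hC hconv h)
      (fun a ha b hb hab => (h a ha b hb hab).2.2.1) hy
  · rcases eq_or_ne u 0 with rfl | hu
    · have h0 : ∀ z, iteratedFDeriv ℝ 2 f z (fun _ => (0 : EuclideanSpace ℝ (Fin n))) = 0 :=
        fun z => by simp [iteratedFDeriv_two_apply]
      simp [h0, zetaPlus, zetaMinus, Real.zero_rpow]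
    · obtain ⟨a, ha, b, hb, hab, t, ht, rfl, c, hc, hcu⟩ := exists_chord hC hconv hx hu
      have h2 := (h a ha b hb hab).2.2.2.2 t ht
      have hnn := (hpos _ hx u hu).le
      rw [limsup_congr (differenceQuotient_comp_chord isOpen_interior hf hx),
        liminf_congr (differenceQuotient_comp_chord isOpen_interior hf hx),
        deriv_deriv_comp_chord isOpen_interior hf hx, deriv_comp_chord isOpen_interior hf hx, hcu,
        limsup_differenceQuotient_smul f _ u hc, liminf_differenceQuotient_smul f _ u hc,
        iteratedFDeriv_two_smul, map_smul, smul_eq_mul, zetaPlus_scale _ _ _ hc.le hnn,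
        zetaMinus_scale _ _ _ hc.le hnn] at h2
      exact ⟨le_of_mul_le_mul_left h2.1 (pow_pos hc 3), le_of_mul_le_mul_left h2.2 (pow_pos hc 3)⟩

end Admissible

/-- A C² function f on the interior of a compact convex set C ⊂ ℝⁿ is
ν-admissible if and only if its restriction to every interval in C° linking two boundary
points of C (affinely parameterized over (−1,1)) is ν-admissible in one variable. -/
theorem stmt_10 {n : ℕ} (ν : ℝ) (hν : 2 ≤ ν) (C : Set (EuclideanSpace ℝ (Fin n)))
    (hCcpt : IsCompact C) (hCconv : Convex ℝ C) (hCint : (interior C).Nonempty)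
    (f : EuclideanSpace ℝ (Fin n) → ℝ) (hf : ContDiffOn ℝ 2 f (interior C)) :
    AdmissibleOn ν C f ↔
      ∀ a b : EuclideanSpace ℝ (Fin n), a ∈ frontier C → b ∈ frontier C →
        openSegment ℝ a b ⊆ interior C →
        Admissible1D ν (fun t : ℝ =>
          f ((1 / 2 : ℝ) • (a + b) + (t / 2) • (b - a))) := by
  exact ⟨fun h a b ha hb hab => h.admissible1D_chord ha hb hab,
    fun h => admissibleOn_of_admissible1D_chords hCcpt hCconv hf
      fun a ha b hb hab => h a b ha hb hab⟩
end

section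
/- Let ν ≥ 2, let C ⊂ ℝⁿ be a compact convex set with interior C°, and let f : C° → ℝ be a C³ function. For every x ∈ C° and every nonzero direction v, let I be the interval obtained by intersecting C with the line x + ℝ·v, parameterize I affinely by t ∈ [−1,1], let f_I : (−1,1) → ℝ be the restriction of f to I, and let p, h, w be the first three derivatives of f_I with respect to t at the parameter value corresponding to x; define p̃ = (1−t²)p − t, h̃ = (1−t²)²h − 2t(1−t²)p + t², w̃ = (1−t²)³w − 6t(1−t²)²h + 6t²(1−t²)p − 2t³ at that parameter value t. Then the following are equivalent: (1) for all x ∈ C° and all nonzero directions v, the triple (p̃, h̃, w̃) is an element of P_ν; (2) f satisfies the ν-barrier conditions on C. -/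
/-- The ν-barrier conditions for a C³ function f on the interior of a compact convex set
C ⊂ ℝⁿ: f''−f'⊗f' positive definite, blow-up at the boundary, and
|f'''[v,v,v] − 6f''[v,v]f'[v] + 4(f'[v])³| ≤ 2γ(f''[v,v] − (f'[v])²)^{3/2}
with γ = (ν−2)/√(ν−1). -/
noncomputable def BarrierCondOn {n : ℕ} (ν : ℝ) (C : Set (EuclideanSpace ℝ (Fin n)))
    (f : EuclideanSpace ℝ (Fin n) → ℝ) : Prop :=
  ContDiffOn ℝ 3 f (interior C) ∧
  (∀ x ∈ interior C, ∀ v : EuclideanSpace ℝ (Fin n), v ≠ 0 →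
    0 < iteratedFDeriv ℝ 2 f x (fun _ => v) - (fderiv ℝ f x v) ^ 2) ∧
  (∀ y ∈ frontier C, Filter.Tendsto f (nhdsWithin y (interior C)) Filter.atTop) ∧
  (∀ x ∈ interior C, ∀ v : EuclideanSpace ℝ (Fin n),
    |iteratedFDeriv ℝ 3 f x (fun _ => v)
        - 6 * iteratedFDeriv ℝ 2 f x (fun _ => v) * fderiv ℝ f x v
        + 4 * (fderiv ℝ f x v) ^ 3| ≤
      2 * ((ν - 2) / Real.sqrt (ν - 1)) *
        (iteratedFDeriv ℝ 2 f x (fun _ => v) - (fderiv ℝ f x v) ^ 2) ^ ((3 : ℝ) / 2))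

open Set Filter Topology

theorem le_inv_of_sq_le_deriv {A A' : ℝ → ℝ} {b : ℝ} (hb : 0 < b)
    (hA : ∀ s ∈ Ico 0 b, HasDerivAt A (A' s) s) (h : ∀ s ∈ Ico 0 b, A s ^ 2 ≤ A' s) :
    A 0 ≤ b⁻¹ := by
  by_contra! hlt
  have h0 : 0 < A 0 := (inv_pos.2 hb).trans hlt
  have hzero : (0 : ℝ) ∈ Ico 0 b := ⟨le_rfl, hb⟩
  have hmono : MonotoneOn A (Ico 0 b) :=
    monotoneOn_of_hasDerivWithinAt_nonneg (convex_Ico 0 b)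
      (fun s hs => (hA s hs).continuousAt.continuousWithinAt)
      (fun s hs => (hA s (interior_subset hs)).hasDerivWithinAt)
      (fun s hs => (sq_nonneg _).trans (h s (interior_subset hs)))
  have hpos : ∀ s ∈ Ico 0 b, 0 < A s := fun s hs => h0.trans_le (hmono hzero hs hs.1)
  have hd : ∀ s ∈ Ico 0 b, HasDerivAt (fun s => (A s)⁻¹ + s) (-A' s / A s ^ 2 + 1) s :=
    fun s hs => ((hA s hs).inv (hpos s hs).ne').add (hasDerivAt_id s)
  have hanti : AntitoneOn (fun s => (A s)⁻¹ + s) (Ico 0 b) :=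
    antitoneOn_of_hasDerivWithinAt_nonpos (convex_Ico 0 b)
      (fun s hs => (hd s hs).continuousAt.continuousWithinAt)
      (fun s hs => (hd s (interior_subset hs)).hasDerivWithinAt)
      (fun s hs => by
        have := interior_subset hs
        have h1 : 1 ≤ A' s / A s ^ 2 := (one_le_div (pow_pos (hpos s this) 2)).2 (h s this)
        rw [neg_div]; linarith)
  have hinv : (A 0)⁻¹ < b := inv_lt_of_inv_lt₀ hb hlt
  have hmem : (A 0)⁻¹ ∈ Ico 0 b := ⟨(inv_pos.2 h0).le, hinv⟩
  have := hanti hzero hmem hmem.1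
  have := inv_pos.2 (hpos _ hmem)
  dsimp only at *
  linarith

theorem exists_upper_bound_of_deriv_le_sq {A A' : ℝ → ℝ} {b : ℝ} (hb : 0 < b)
    (hA : ∀ s ∈ Ico 0 b, HasDerivAt A (A' s) s) (h : ∀ s ∈ Ico 0 b, A' s ≤ A s ^ 2)
    (hlt : A 0 < b⁻¹) : ∃ M, ∀ s ∈ Ico 0 b, A s ≤ M := by
  obtain ⟨m, hm, hmb⟩ := exists_between (max_lt hlt (inv_pos.2 hb))
  obtain ⟨hAm, hm0⟩ := max_lt_iff.1 hm
  have hmb1 : m * b < 1 := by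
    have := mul_lt_mul_of_pos_right hmb hb
    rwa [inv_mul_cancel₀ hb.ne'] at this
  obtain ⟨k, hk, hk1⟩ := exists_between hmb1
  have hk0 : 0 < k := (mul_pos hm0 hb).trans hk
  set T := k / m with hT
  have hbT : b < T := by rw [hT, lt_div_iff₀ hm0, mul_comm]; exact hk
  refine ⟨k / (T - b), fun s hs => ?_⟩
  have hB : ∀ x ∈ Ico 0 b, HasDerivAt (fun x => k / (T - x)) (k / (T - x) ^ 2) x := by
    intro x hx
    have hne : T - x ≠ 0 := by linarith [hx.2]
    have h1 : HasDerivAt (fun x => T - x) (-1) x := by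
      simpa using (hasDerivAt_id x).const_sub T
    simpa using (hasDerivAt_const x k).fun_div h1 hne
  have hsub : ∀ x ∈ Icc 0 s, x ∈ Ico 0 b := fun x hx => ⟨hx.1, hx.2.trans_lt hs.2⟩
  have hsub' : ∀ x ∈ Ico 0 s, x ∈ Ico 0 b := fun x hx => hsub x ⟨hx.1, hx.2.le⟩
  have key := image_le_of_deriv_right_lt_deriv_boundary'
    (f := A) (f' := A') (a := 0) (b := s)
    (fun x hx => (hA x (hsub x hx)).continuousAt.continuousWithinAt)
    (fun x hx => (hA x (hsub' x hx)).hasDerivWithinAt)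
    (B := fun x => k / (T - x)) (B' := fun x => k / (T - x) ^ 2)
    (by rw [sub_zero, hT, div_div_cancel₀ hk0.ne']; exact hAm.le)
    (fun x hx => (hB x (hsub x hx)).continuousAt.continuousWithinAt)
    (fun x hx => (hB x (hsub' x hx)).hasDerivWithinAt)
    (fun x hx hxB => by
      have hx' := hsub' x hx
      refine (h x hx').trans_lt ?_
      have : 0 < T - x := by linarith [hx'.2]
      rw [hxB, div_pow]
      gcongr
      nlinarith)
    (right_mem_Icc.2 hs.1)
  refine key.trans ?_
  have : 0 < T - b := by linarith
  gcongr
  exact hs.2.le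

/-- One-sided estimates at the right end of the interval: Riccati comparison for
`p ± λ √(h - p²)`. -/
theorem right_endpoint_bounds {F p h w : ℝ → ℝ} {b μ : ℝ} (hb : 0 < b) (hμ : 0 < μ)
    (hF : ∀ s ∈ Ico 0 b, HasDerivAt F (p s) s) (hp : ∀ s ∈ Ico 0 b, HasDerivAt p (h s) s)
    (hh : ∀ s ∈ Ico 0 b, HasDerivAt h (w s) s)
    (hpos : ∀ s ∈ Ico 0 b, 0 < h s - p s ^ 2)
    (hw : ∀ s ∈ Ico 0 b, |w s - 6 * h s * p s + 4 * p s ^ 3| ≤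
      2 * (μ - μ⁻¹) * √(h s - p s ^ 2) ^ 3)
    (hlim : Tendsto F (𝓝[<] b) atTop) :
    p 0 + √(h 0 - p 0 ^ 2) / μ ≤ b⁻¹ ∧ b⁻¹ ≤ p 0 + μ * √(h 0 - p 0 ^ 2) := by
  set q : ℝ → ℝ := fun s => √(h s - p s ^ 2) with hq
  have hq0 : ∀ s ∈ Ico 0 b, 0 < q s := fun s hs => Real.sqrt_pos.2 (hpos s hs)
  have hqsq : ∀ s ∈ Ico 0 b, q s ^ 2 = h s - p s ^ 2 := fun s hs => Real.sq_sqrt (hpos s hs).le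
  set d : ℝ → ℝ := fun s => (w s - 2 * h s * p s) / (2 * q s) with hd
  have hqd : ∀ s ∈ Ico 0 b, HasDerivAt q (d s) s := by
    intro s hs
    have := ((hh s hs).fun_sub ((hp s hs).fun_pow 2)).sqrt (hpos s hs).ne'
    convert this using 1
    simp only [hd, hq]; congr 1; push_cast; ring
  have hdq : ∀ s ∈ Ico 0 b, |d s - 2 * p s * q s| ≤ (μ - μ⁻¹) * q s ^ 2 := by
    intro s hs
    have h1 := hw s hs
    have hq' := hq0 s hs
    have hds : d s * (2 * q s) = w s - 2 * h s * p s := div_mul_cancel₀ _ (by positivity)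
    have h2 : w s - 6 * h s * p s + 4 * p s ^ 3 = (2 * q s) * (d s - 2 * p s * q s) := by
      have := hqsq s hs
      linear_combination -hds + 4 * p s * this
    change _ ≤ 2 * (μ - μ⁻¹) * q s ^ 3 at h1
    rw [h2, abs_mul, abs_of_pos (by positivity : 0 < 2 * q s)] at h1
    refine le_of_mul_le_mul_left (h1.trans_eq ?_) (by positivity : 0 < 2 * q s)
    ring
  constructor
  · refine le_inv_of_sq_le_deriv (A := fun s => p s + q s / μ) (A' := fun s => h s + d s / μ) hb
      (fun s hs => (hp s hs).add ((hqd s hs).div_const μ)) (fun s hs => ?_)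
    have h1 := (abs_le.1 (hdq s hs)).1
    have h2 := hqsq s hs
    have h3 : (2 * p s * q s - (μ - μ⁻¹) * q s ^ 2) / μ ≤ d s / μ := by
      gcongr; linarith
    calc (p s + q s / μ) ^ 2
        = p s ^ 2 + q s ^ 2 + (2 * p s * q s - (μ - μ⁻¹) * q s ^ 2) / μ := by
          field_simp; ring
      _ ≤ h s + d s / μ := by linarith
  · by_contra! hlt
    obtain ⟨M, hM⟩ := exists_upper_bound_of_deriv_le_sq (A := fun s => p s + μ * q s)
      (A' := fun s => h s + μ * d s) hb
      (fun s hs => (hp s hs).add ((hqd s hs).const_mul μ)) (fun s hs => by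
        have h1 := (abs_le.1 (hdq s hs)).2
        have h2 := hqsq s hs
        have h3 : μ * d s ≤ μ * (2 * p s * q s + (μ - μ⁻¹) * q s ^ 2) := by
          gcongr; linarith
        calc h s + μ * d s ≤ p s ^ 2 + q s ^ 2 + μ * (2 * p s * q s + (μ - μ⁻¹) * q s ^ 2) := by
              linarith
          _ = (p s + μ * q s) ^ 2 := by field_simp; ring) hlt
    have hpM : ∀ s ∈ Ico 0 b, p s ≤ M := fun s hs => by
      linarith [hM s hs, mul_pos hμ (hq0 s hs)]
    have hd' : ∀ s ∈ Ico 0 b, HasDerivAt (fun s => F s - M * s) (p s - M) s := fun s hs => by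
      simpa using (hF s hs).fun_sub ((hasDerivAt_id s).const_mul M)
    have hanti : AntitoneOn (fun s => F s - M * s) (Ico 0 b) :=
      antitoneOn_of_hasDerivWithinAt_nonpos (convex_Ico 0 b)
        (fun s hs => (hd' s hs).continuousAt.continuousWithinAt)
        (fun s hs => (hd' s (interior_subset hs)).hasDerivWithinAt)
        (fun s hs => by linarith [hpM s (interior_subset hs)])
    have hev : ∀ᶠ s in 𝓝[<] b, F 0 + |M| * b < F s := hlim.eventually_gt_atTop _
    obtain ⟨s, hs, hs'⟩ := (hev.and (Ioo_mem_nhdsLT hb)).exists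
    have h1 := hanti ⟨le_rfl, hb⟩ ⟨hs'.1.le, hs'.2⟩ hs'.1.le
    have h2 : M * s ≤ |M| * b :=
      mul_le_mul (le_abs_self M) hs'.2.le hs'.1.le (abs_nonneg M)
    simp only [mul_zero, sub_zero] at h1
    linarith

theorem rpow_three_halves (x : ℝ) : x ^ ((3 : ℝ) / 2) = √x ^ 3 := by
  rcases le_or_gt 0 x with hx | hx
  · rw [Real.sqrt_eq_rpow, ← Real.rpow_natCast, ← Real.rpow_mul hx]
    norm_num
  · have h : Real.cos (3 / 2 * Real.pi) = 0 :=
      Real.cos_eq_zero_iff.2 ⟨1, by push_cast; ring⟩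
    rw [Real.rpow_def_of_neg hx, h, Real.sqrt_eq_zero_of_nonpos hx.le]
    simp

section Chord

variable {E : Type*} [NormedAddCommGroup E] [NormedSpace ℝ E]

/-- The line `x + ℝ v` meets `C` with extreme parameters `-a` and `b`. -/
def IsChord (C : Set E) (x v : E) (a b : ℝ) : Prop :=
  IsLeast {s : ℝ | x + s • v ∈ C} (-a) ∧ IsGreatest {s : ℝ | x + s • v ∈ C} b

variable {C : Set E} {x v : E} {a b : ℝ}

theorem exists_isChord (hC : IsCompact C) (hx : x ∈ C) (hv : v ≠ 0) :
    ∃ a b, IsChord C x v a b := by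
  have hemb : IsClosedEmbedding (fun s : ℝ => x + s • v) :=
    (Homeomorph.addLeft x).isClosedEmbedding.comp (isClosedEmbedding_smul_left hv)
  have hcpt : IsCompact {s : ℝ | x + s • v ∈ C} := hemb.isCompact_preimage hC
  have hne : {s : ℝ | x + s • v ∈ C}.Nonempty := ⟨0, by simpa using hx⟩
  obtain ⟨l, hl⟩ := hcpt.exists_isLeast hne
  obtain ⟨g, hg⟩ := hcpt.exists_isGreatest hne
  exact ⟨-l, g, by rwa [neg_neg], hg⟩

theorem IsChord.neg (h : IsChord C x v a b) : IsChord C x (-v) b a := by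
  refine ⟨⟨?_, fun s hs => ?_⟩, ?_, fun s hs => ?_⟩
  · simpa using h.2.1
  · have : -s ≤ b := h.2.2 (show x + (-s) • v ∈ C by simpa using hs)
    linarith
  · simpa using h.1.1
  · have : -a ≤ -s := h.1.2 (show x + (-s) • v ∈ C by simpa using hs)
    linarith

theorem IsChord.shift (h : IsChord C x v a b) (s : ℝ) :
    IsChord C (x + s • v) v (a + s) (b - s) := by
  have key : ∀ r : ℝ, x + s • v + r • v = x + (s + r) • v := fun r => by
    rw [add_smul, add_assoc]
  refine ⟨⟨?_, fun r hr => ?_⟩, ?_, fun r hr => ?_⟩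
  · simpa [key] using h.1.1
  · have : -a ≤ s + r := h.1.2 (show x + (s + r) • v ∈ C by simpa [key] using hr)
    linarith
  · simpa [key] using h.2.1
  · have : s + r ≤ b := h.2.2 (show x + (s + r) • v ∈ C by simpa [key] using hr)
    linarith

theorem IsChord.right_pos (h : IsChord C x v a b) (hx : x ∈ interior C) : 0 < b := by
  have hc : Tendsto (fun s : ℝ => x + s • v) (𝓝[>] 0) (𝓝 x) := by
    have : Continuous (fun s : ℝ => x + s • v) := by fun_prop
    simpa using (this.tendsto 0).mono_left nhdsWithin_le_nhds
  obtain ⟨s, hs, hs0⟩ := ((hc.eventually (mem_interior_iff_mem_nhds.1 hx)).and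
    self_mem_nhdsWithin).exists
  exact lt_of_lt_of_le hs0 (h.2.2 hs)

theorem IsChord.left_pos (h : IsChord C x v a b) (hx : x ∈ interior C) : 0 < a :=
  h.neg.right_pos hx

theorem IsChord.right_mem_frontier (h : IsChord C x v a b) : x + b • v ∈ frontier C :=
  ⟨subset_closure h.2.1, fun hi => by simpa using (h.shift b).right_pos hi⟩

theorem IsChord.mem_interior_of_nonneg (h : IsChord C x v a b) (hC : Convex ℝ C)
    (hx : x ∈ interior C) {s : ℝ} (hs : s ∈ Ico 0 b) : x + s • v ∈ interior C := by
  have hb := h.right_pos hx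
  have h1 : 0 < 1 - s / b := by rw [sub_pos, div_lt_one hb]; exact hs.2
  have := hC.combo_interior_self_mem_interior hx h.2.1 h1 (div_nonneg hs.1 hb.le) (by ring)
  convert this using 1
  rw [smul_add, ← add_assoc, ← add_smul, smul_smul, div_mul_cancel₀ _ hb.ne']
  simp

theorem IsChord.mem_interior (h : IsChord C x v a b) (hC : Convex ℝ C)
    (hx : x ∈ interior C) {s : ℝ} (hs : s ∈ Ioo (-a) b) : x + s • v ∈ interior C := by
  rcases le_total 0 s with h0 | h0
  · exact h.mem_interior_of_nonneg hC hx ⟨h0, hs.2⟩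
  · simpa using h.neg.mem_interior_of_nonneg hC hx (s := -s) ⟨by linarith, by linarith [hs.1]⟩

theorem hasDerivAt_iteratedFDeriv_line {f : E → ℝ} {n : WithTop ℕ∞} {k : ℕ} {s : ℝ}
    (hf : ContDiffAt ℝ n f (x + s • v)) (hk : k < n) :
    HasDerivAt (fun r : ℝ => iteratedFDeriv ℝ k f (x + r • v) (fun _ => v))
      (iteratedFDeriv ℝ (k + 1) f (x + s • v) (fun _ => v)) s := by
  have h1 : HasDerivAt (fun r : ℝ => x + r • v) v s := by
    simpa using ((hasDerivAt_id s).smul_const v).const_add x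
  have h2 := (hf.differentiableAt_iteratedFDeriv hk).hasFDerivAt.comp_hasDerivAt s h1
  have h3 := (ContinuousMultilinearMap.apply ℝ (fun _ : Fin k => E) ℝ
    (fun _ => v)).hasFDerivAt.comp_hasDerivAt s h2
  rw [iteratedFDeriv_succ_apply_left]
  exact h3

theorem iteratedDeriv_line {f : E → ℝ} {U : Set E} (hU : IsOpen U) {n : WithTop ℕ∞}
    (hf : ContDiffOn ℝ n f U) {k : ℕ} (hk : k ≤ n) {s : ℝ} (hs : x + s • v ∈ U) :
    iteratedDeriv k (fun r : ℝ => f (x + r • v)) s =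
      iteratedFDeriv ℝ k f (x + s • v) (fun _ => v) := by
  induction k generalizing s with
  | zero => simp
  | succ k ih =>
    have hk' : (k : WithTop ℕ∞) < n := lt_of_lt_of_le (by exact_mod_cast k.lt_succ_self) hk
    have hev : ∀ᶠ r in 𝓝 s, x + r • v ∈ U :=
      (Continuous.continuousAt (by fun_prop)).eventually_mem (hU.mem_nhds hs)
    have heq : iteratedDeriv k (fun r : ℝ => f (x + r • v)) =ᶠ[𝓝 s]
        fun r => iteratedFDeriv ℝ k f (x + r • v) (fun _ => v) :=
      hev.mono fun r hr => ih hk'.le hr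
    rw [iteratedDeriv_succ, heq.deriv_eq]
    exact (hasDerivAt_iteratedFDeriv_line (hf.contDiffAt (hU.mem_nhds hs)) hk').deriv

theorem iteratedFDeriv_const_smul (f : E → ℝ) (k : ℕ) (x v : E) (c : ℝ) :
    iteratedFDeriv ℝ k f x (fun _ => c • v) = c ^ k * iteratedFDeriv ℝ k f x (fun _ => v) := by
  simpa using (iteratedFDeriv ℝ k f x).map_smul_univ (fun _ => c) (fun _ => v)

end Chord

/-- The uncentred form of membership in `Pset ν` with `μ = √(ν - 1)`, on a chord with end
parameters `-a` and `b`. -/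
def ChordBounds (μ p h w a b : ℝ) : Prop :=
  √(h - p ^ 2) / μ ≤ p + a⁻¹ ∧ p + a⁻¹ ≤ μ * √(h - p ^ 2) ∧
  √(h - p ^ 2) / μ ≤ b⁻¹ - p ∧ b⁻¹ - p ≤ μ * √(h - p ^ 2) ∧
  |w - 6 * h * p + 4 * p ^ 3| ≤ 2 * (μ - μ⁻¹) * √(h - p ^ 2) ^ 3

theorem sub_two_div_sqrt {ν : ℝ} (hν : 2 ≤ ν) :
    (ν - 2) / √(ν - 1) = √(ν - 1) - (√(ν - 1))⁻¹ := by
  have h1 : √(ν - 1) ^ 2 = ν - 1 := Real.sq_sqrt (by linarith)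
  have h2 : 0 < √(ν - 1) := Real.sqrt_pos.2 (by linarith)
  field_simp
  linarith

theorem mem_Pset_iff_chordBounds {ν : ℝ} (hν : 2 ≤ ν) {a b p h w l t : ℝ} (ha : 0 < a)
    (hb : 0 < b) (hl : l = (a + b) / 2) (ht : t = (a - b) / (a + b)) :
    ((1 - t ^ 2) * (l * p) - t,
      (1 - t ^ 2) ^ 2 * (l ^ 2 * h) - 2 * t * (1 - t ^ 2) * (l * p) + t ^ 2,
      (1 - t ^ 2) ^ 3 * (l ^ 3 * w) - 6 * t * (1 - t ^ 2) ^ 2 * (l ^ 2 * h)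
        + 6 * t ^ 2 * (1 - t ^ 2) * (l * p) - 2 * t ^ 3) ∈ Pset ν ↔
    ChordBounds √(ν - 1) p h w a b := by
  have hab : 0 < a + b := add_pos ha hb
  obtain ⟨κ, hκdef⟩ : ∃ κ, κ = (1 - t ^ 2) * l := ⟨_, rfl⟩
  have hκ' : κ = 2 * a * b / (a + b) := by rw [hκdef, hl, ht]; field_simp; ring
  have hκ : 0 < κ := by rw [hκ']; positivity
  have e1 : 1 + ((1 - t ^ 2) * (l * p) - t) = κ * (p + a⁻¹) := by
    rw [← mul_assoc, ← hκdef, hκ', ht]; field_simp; ring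
  have e2 : 1 - ((1 - t ^ 2) * (l * p) - t) = κ * (b⁻¹ - p) := by
    rw [← mul_assoc, ← hκdef, hκ', ht]; field_simp; ring
  have e3 : (1 - t ^ 2) ^ 2 * (l ^ 2 * h) - 2 * t * (1 - t ^ 2) * (l * p) + t ^ 2
      - ((1 - t ^ 2) * (l * p) - t) ^ 2 = κ ^ 2 * (h - p ^ 2) := by rw [hκdef]; ring
  have e4 : (1 - t ^ 2) ^ 3 * (l ^ 3 * w) - 6 * t * (1 - t ^ 2) ^ 2 * (l ^ 2 * h)
        + 6 * t ^ 2 * (1 - t ^ 2) * (l * p) - 2 * t ^ 3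
      - 6 * ((1 - t ^ 2) ^ 2 * (l ^ 2 * h) - 2 * t * (1 - t ^ 2) * (l * p) + t ^ 2)
        * ((1 - t ^ 2) * (l * p) - t) + 4 * ((1 - t ^ 2) * (l * p) - t) ^ 3
      = κ ^ 3 * (w - 6 * h * p + 4 * p ^ 3) := by rw [hκdef]; ring
  have e5 : √(κ ^ 2 * (h - p ^ 2)) = κ * √(h - p ^ 2) := by
    rw [Real.sqrt_mul (sq_nonneg κ), Real.sqrt_sq hκ.le]
  simp only [Pset, mem_ofPred_eq, e1, e2, e3, e4, rpow_three_halves, e5, sub_two_div_sqrt hν,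
    ChordBounds]
  rw [abs_mul, abs_of_pos (pow_pos hκ 3), mul_div_assoc, mul_left_comm _ κ, mul_pow,
    mul_left_comm _ (κ ^ 3)]
  simp only [mul_le_mul_iff_right₀ hκ, mul_le_mul_iff_right₀ (pow_pos hκ 3)]

theorem ChordBounds.sub_sq_pos {μ p h w a b : ℝ} (H : ChordBounds μ p h w a b) (hμ : 0 < μ)
    (ha : 0 < a) (hb : 0 < b) : 0 < h - p ^ 2 := by
  obtain ⟨-, h2, -, h4, -⟩ := H
  have h0 : 0 < μ * √(h - p ^ 2) := by linarith [inv_pos.2 ha, inv_pos.2 hb]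
  exact Real.sqrt_pos.1 (pos_of_mul_pos_right h0 hμ.le)

theorem ChordBounds.le_first_deriv {μ p h w a b : ℝ} (H : ChordBounds μ p h w a b)
    (hμ : 0 < μ) :
    (2 * μ ^ 2)⁻¹ * b⁻¹ - (1 - (2 * μ ^ 2)⁻¹) * a⁻¹ ≤ p := by
  obtain ⟨h1, h2, -, h4, -⟩ := H
  have h5 : (a⁻¹ + b⁻¹) / (2 * μ) / μ ≤ √(h - p ^ 2) / μ := by
    gcongr
    rw [div_le_iff₀ (by positivity)]
    linarith
  have h6 : (a⁻¹ + b⁻¹) / (2 * μ) / μ = (2 * μ ^ 2)⁻¹ * (a⁻¹ + b⁻¹) := by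
    rw [div_div, div_eq_inv_mul]; ring_nf
  linarith

theorem add_log_le_of_deriv_ge {F p : ℝ → ℝ} {a b α : ℝ} (ha : 0 < a) (hb : 1 < b)
    (hF : ∀ s ∈ Icc (0 : ℝ) 1, HasDerivAt F (p s) s)
    (hp : ∀ s ∈ Icc (0 : ℝ) 1, α * (b - s)⁻¹ - (1 - α) * (a + s)⁻¹ ≤ p s) :
    F 0 + α * Real.log (b / (b - 1)) - (1 - α) * Real.log ((a + 1) / a) ≤ F 1 := by
  have hd : ∀ s ∈ Icc (0 : ℝ) 1,
      HasDerivAt (fun s => F s + α * Real.log (b - s) + (1 - α) * Real.log (a + s))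
        (p s + α * (-1 / (b - s)) + (1 - α) * (1 / (a + s))) s := fun s hs => by
    have h1 : b - s ≠ 0 := by linarith [hs.2]
    have h2 : a + s ≠ 0 := by linarith [hs.1]
    exact ((hF s hs).add ((((hasDerivAt_id s).const_sub b).log h1).const_mul α)).add
      ((((hasDerivAt_id s).const_add a).log h2).const_mul (1 - α))
  have hmono := monotoneOn_of_hasDerivWithinAt_nonneg (convex_Icc (0 : ℝ) 1)
    (fun s hs => (hd s hs).continuousAt.continuousWithinAt)
    (fun s hs => (hd s (interior_subset hs)).hasDerivWithinAt)
    (fun s hs => by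
      have := hp s (interior_subset hs)
      rw [neg_div, one_div, one_div]
      linarith)
  have := hmono (left_mem_Icc.2 zero_le_one) (right_mem_Icc.2 zero_le_one) zero_le_one
  rw [Real.log_div (by linarith) (by linarith), Real.log_div (by linarith) ha.ne']
  simp only [sub_zero, add_zero] at this
  linarith

section Barrier

variable {E : Type*} [NormedAddCommGroup E] [NormedSpace ℝ E] {C : Set E} {f : E → ℝ}

/-- A logarithmic lower bound on the directional derivatives along chords forces blow-up at
the boundary. -/
theorem tendsto_atTop_of_le_fderiv (hcpt : IsCompact C) (hC : Convex ℝ C)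
    (hf : ∀ x ∈ interior C, DifferentiableAt ℝ f x) {α : ℝ} (hα : 0 < α) (hα1 : α ≤ 1)
    (H : ∀ x ∈ interior C, ∀ v ≠ 0, ∀ a b, IsChord C x v a b →
      α * b⁻¹ - (1 - α) * a⁻¹ ≤ fderiv ℝ f x v)
    {y : E} (hy : y ∈ frontier C) : Tendsto f (𝓝[interior C] y) atTop := by
  rcases (interior C).eq_empty_or_nonempty with he | ⟨x₀, hx₀⟩
  · simp [he]
  obtain ⟨r, hr, hball⟩ := Metric.nhds_basis_closedBall.mem_iff.1 (isOpen_interior.mem_nhds hx₀)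
  obtain ⟨D, hD⟩ := Metric.isBounded_iff.1 hcpt.isBounded
  have hyi : y ∉ interior C := hy.2
  have hx₀y : x₀ ≠ y := fun h => hyi (h ▸ hx₀)
  have key : ∀ x ∈ interior C, x ≠ x₀ →
      f x₀ + α * Real.log (r / ‖x - y‖) - (1 - α) * Real.log (D / r) ≤ f x := by
    intro x hx hxx
    have hv : x - x₀ ≠ 0 := sub_ne_zero.2 hxx
    have hv0 : 0 < ‖x - x₀‖ := norm_pos_iff.2 hv
    have hxy : 0 < ‖x - y‖ := norm_pos_iff.2 (sub_ne_zero.2 fun h => hyi (h ▸ hx))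
    obtain ⟨a, b, hch⟩ := exists_isChord hcpt (interior_subset hx₀) hv
    have ha := hch.left_pos hx₀
    have hx1 : x₀ + (1 : ℝ) • (x - x₀) = x := by simp
    have hb : 1 < b := by
      have := (hch.shift 1).right_pos (by rwa [hx1])
      linarith
    have hbase : f x₀ + α * Real.log (b / (b - 1)) - (1 - α) * Real.log ((a + 1) / a) ≤ f x := by
      have hint : ∀ s ∈ Icc (0 : ℝ) 1, x₀ + s • (x - x₀) ∈ interior C := fun s hs =>
        hch.mem_interior_of_nonneg hC hx₀ ⟨hs.1, hs.2.trans_lt hb⟩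
      have := add_log_le_of_deriv_ge (F := fun s => f (x₀ + s • (x - x₀)))
        (p := fun s => fderiv ℝ f (x₀ + s • (x - x₀)) (x - x₀)) (α := α) ha hb
        (fun s hs => by
          have h1 : HasDerivAt (fun r : ℝ => x₀ + r • (x - x₀)) (x - x₀) s := by
            simpa using ((hasDerivAt_id s).smul_const (x - x₀)).const_add x₀
          exact (hf _ (hint s hs)).hasFDerivAt.comp_hasDerivAt s h1)
        (fun s hs => H _ (hint s hs) _ hv _ _ (hch.shift s))
      simpa using this
    have hdist : (b - 1) / b ≤ ‖x - y‖ / r := by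
      by_contra! hlt
      set c := (b - 1) / b with hc
      have hb0 : 0 < b := by linarith
      have hc0 : 0 < c := div_pos (by linarith) hb0
      have hcb : (1 - c) * b = 1 := by rw [hc]; field_simp; ring
      have hz : x₀ + c⁻¹ • (y - x) ∈ interior C := by
        apply hball
        rw [mem_closedBall_iff_norm, add_sub_cancel_left, norm_smul, norm_inv,
          Real.norm_of_nonneg hc0.le, norm_sub_rev, inv_mul_le_iff₀ hc0]
        exact ((div_lt_iff₀ hr).1 hlt).le
      have hc1 : 0 ≤ 1 - c := by
        by_contra! hneg
        nlinarith
      have := hC.combo_interior_self_mem_interior hz hch.2.1 hc0 hc1 (by ring)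
      refine hyi ?_
      convert this using 1
      rw [smul_add, smul_add, smul_smul, smul_smul, mul_inv_cancel₀ hc0.ne', hcb]
      module
    have hlog1 : Real.log (r / ‖x - y‖) ≤ Real.log (b / (b - 1)) := by
      refine Real.log_le_log (by positivity) ?_
      rw [← inv_div, ← inv_div (b - 1)]
      exact inv_anti₀ (div_pos (by linarith) (by linarith)) hdist
    have hra : r ≤ a * ‖x - x₀‖ := by
      have hmem : x₀ + (-(r / ‖x - x₀‖)) • (x - x₀) ∈ C := by
        apply interior_subset
        apply hball
        rw [mem_closedBall_iff_norm, add_sub_cancel_left, norm_smul, norm_neg, norm_div,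
          norm_norm, Real.norm_of_nonneg hr.le, div_mul_cancel₀ _ hv0.ne']
      have : -a ≤ -(r / ‖x - x₀‖) := hch.1.2 hmem
      exact (div_le_iff₀ hv0).1 (neg_le_neg_iff.1 this)
    have haD : (a + 1) * ‖x - x₀‖ ≤ D := by
      have h1 := hD (interior_subset hx) hch.1.1
      have h2 : x - (x₀ + (-a) • (x - x₀)) = (a + 1) • (x - x₀) := by module
      rwa [dist_eq_norm, h2, norm_smul, Real.norm_of_nonneg (by linarith)] at h1
    have hlog2 : Real.log ((a + 1) / a) ≤ Real.log (D / r) := by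
      refine Real.log_le_log (by positivity) ?_
      rw [← mul_div_mul_right (a + 1) a hv0.ne']
      exact div_le_div₀ ((by positivity : 0 ≤ (a + 1) * ‖x - x₀‖).trans haD) haD hr hra
    have h3 := mul_le_mul_of_nonneg_left hlog1 hα.le
    have h4 := mul_le_mul_of_nonneg_left hlog2 (sub_nonneg.2 hα1)
    linarith
  have hle : 𝓝[interior C] y ≤ 𝓝[≠] y :=
    nhdsWithin_mono y fun x hx => ne_of_mem_of_not_mem hx hyi
  have hlim : Tendsto (fun x => Real.log (r / ‖x - y‖)) (𝓝[interior C] y) atTop := by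
    have h1 : Tendsto (fun x => ‖x - y‖) (𝓝[interior C] y) (𝓝[>] 0) :=
      (tendsto_norm_sub_self_nhdsNE y).mono_left hle
    refine Real.tendsto_log_atTop.comp ?_
    simp_rw [div_eq_mul_inv]
    exact (tendsto_inv_nhdsGT_zero.comp h1).const_mul_atTop hr
  have hlim2 := tendsto_atTop_add_const_right _ (-((1 - α) * Real.log (D / r)))
    (tendsto_atTop_add_const_left _ (f x₀) (hlim.const_mul_atTop hα))
  refine tendsto_atTop_mono' _ ?_ hlim2
  have hne : ∀ᶠ x in 𝓝[interior C] y, x ≠ x₀ :=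
    nhdsWithin_le_nhds (eventually_ne_nhds hx₀y.symm)
  filter_upwards [hne, self_mem_nhdsWithin] with x hx hxC
  simpa [sub_eq_add_neg] using key x hxC hx

/-- The two estimates at the forward end of a chord. -/
theorem chord_right_bounds {μ : ℝ} (hμ : 0 < μ) (hC : Convex ℝ C)
    (hf : ContDiffOn ℝ 3 f (interior C))
    (hpos : ∀ x ∈ interior C, ∀ v ≠ 0,
      0 < iteratedFDeriv ℝ 2 f x (fun _ => v) - (fderiv ℝ f x v) ^ 2)
    (hlim : ∀ y ∈ frontier C, Tendsto f (𝓝[interior C] y) atTop)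
    (hthird : ∀ x ∈ interior C, ∀ v,
      |iteratedFDeriv ℝ 3 f x (fun _ => v)
        - 6 * iteratedFDeriv ℝ 2 f x (fun _ => v) * fderiv ℝ f x v
        + 4 * (fderiv ℝ f x v) ^ 3| ≤ 2 * (μ - μ⁻¹) *
          √(iteratedFDeriv ℝ 2 f x (fun _ => v) - (fderiv ℝ f x v) ^ 2) ^ 3)
    {x v : E} {a b : ℝ} (hx : x ∈ interior C) (hv : v ≠ 0) (hch : IsChord C x v a b) :
    fderiv ℝ f x v + √(iteratedFDeriv ℝ 2 f x (fun _ => v) - (fderiv ℝ f x v) ^ 2) / μ ≤ b⁻¹ ∧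
    b⁻¹ ≤ fderiv ℝ f x v +
      μ * √(iteratedFDeriv ℝ 2 f x (fun _ => v) - (fderiv ℝ f x v) ^ 2) := by
  have hb := hch.right_pos hx
  have hint : ∀ s ∈ Ico 0 b, x + s • v ∈ interior C :=
    fun s hs => hch.mem_interior_of_nonneg hC hx hs
  have hfc : ∀ s ∈ Ico 0 b, ContDiffAt ℝ 3 f (x + s • v) :=
    fun s hs => hf.contDiffAt (isOpen_interior.mem_nhds (hint s hs))
  have hFlim : Tendsto (fun s : ℝ => f (x + s • v)) (𝓝[<] b) atTop := by
    refine (hlim _ hch.right_mem_frontier).comp (tendsto_nhdsWithin_iff.2 ⟨?_, ?_⟩)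
    · have : Continuous fun s : ℝ => x + s • v := by fun_prop
      exact (this.tendsto b).mono_left nhdsWithin_le_nhds
    · filter_upwards [Ioo_mem_nhdsLT hb] with s hs using hint s ⟨hs.1.le, hs.2⟩
  have := right_endpoint_bounds (F := fun s => f (x + s • v))
    (p := fun s => fderiv ℝ f (x + s • v) v)
    (h := fun s => iteratedFDeriv ℝ 2 f (x + s • v) (fun _ => v))
    (w := fun s => iteratedFDeriv ℝ 3 f (x + s • v) (fun _ => v)) hb hμ
    (fun s hs => by
      simpa using hasDerivAt_iteratedFDeriv_line (k := 0) (hfc s hs) (by norm_num))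
    (fun s hs => by
      simpa using hasDerivAt_iteratedFDeriv_line (k := 1) (hfc s hs) (by norm_num))
    (fun s hs => hasDerivAt_iteratedFDeriv_line (k := 2) (hfc s hs) (by norm_num))
    (fun s hs => hpos _ (hint s hs) v hv) (fun s hs => hthird _ (hint s hs) v) hFlim
  simpa using this

end Barrier

/-- For a C³ function f on the interior of a compact convex set C ⊂ ℝⁿ, the
following are equivalent: (1) for every interior point x and nonzero direction v, with the
chord of C through x in direction v affinely parameterized over [−1,1] and p,h,w the first
three derivatives of the restriction at the parameter t corresponding to x, the centered
triple (p̃,h̃,w̃) lies in P_ν; (2) f satisfies the ν-barrier conditions on C. -/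
theorem stmt_11 {n : ℕ} (ν : ℝ) (hν : 2 ≤ ν) (C : Set (EuclideanSpace ℝ (Fin n)))
    (hCcpt : IsCompact C) (hCconv : Convex ℝ C) (hCint : (interior C).Nonempty)
    (f : EuclideanSpace ℝ (Fin n) → ℝ) (hf : ContDiffOn ℝ 3 f (interior C)) :
    (∀ x ∈ interior C, ∀ v : EuclideanSpace ℝ (Fin n), v ≠ 0 →
      letI tm : ℝ := sInf {s : ℝ | x + s • v ∈ C}
      letI tp : ℝ := sSup {s : ℝ | x + s • v ∈ C}
      letI g : ℝ → ℝ := fun s => f (x + ((tm + tp) / 2 + s * (tp - tm) / 2) • v)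
      letI t : ℝ := -(tm + tp) / (tp - tm)
      ((1 - t ^ 2) * deriv g t - t,
        (1 - t ^ 2) ^ 2 * iteratedDeriv 2 g t - 2 * t * (1 - t ^ 2) * deriv g t + t ^ 2,
        (1 - t ^ 2) ^ 3 * iteratedDeriv 3 g t - 6 * t * (1 - t ^ 2) ^ 2 * iteratedDeriv 2 g t
          + 6 * t ^ 2 * (1 - t ^ 2) * deriv g t - 2 * t ^ 3) ∈ Pset ν) ↔
    BarrierCondOn ν C f := by
  have hμ : 0 < √(ν - 1) := Real.sqrt_pos.2 (by linarith)
  have hμ1 : 1 ≤ √(ν - 1) := Real.one_le_sqrt.2 (by linarith)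
  have hiff : ∀ x ∈ interior C, ∀ v : EuclideanSpace ℝ (Fin n), v ≠ 0 → ∀ a b,
      IsChord C x v a b →
      (letI tm : ℝ := sInf {s : ℝ | x + s • v ∈ C}
      letI tp : ℝ := sSup {s : ℝ | x + s • v ∈ C}
      letI g : ℝ → ℝ := fun s => f (x + ((tm + tp) / 2 + s * (tp - tm) / 2) • v)
      letI t : ℝ := -(tm + tp) / (tp - tm)
      ((1 - t ^ 2) * deriv g t - t,
        (1 - t ^ 2) ^ 2 * iteratedDeriv 2 g t - 2 * t * (1 - t ^ 2) * deriv g t + t ^ 2,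
        (1 - t ^ 2) ^ 3 * iteratedDeriv 3 g t - 6 * t * (1 - t ^ 2) ^ 2 * iteratedDeriv 2 g t
          + 6 * t ^ 2 * (1 - t ^ 2) * deriv g t - 2 * t ^ 3) ∈ Pset ν ↔
      ChordBounds √(ν - 1) (fderiv ℝ f x v) (iteratedFDeriv ℝ 2 f x (fun _ => v))
        (iteratedFDeriv ℝ 3 f x (fun _ => v)) a b) := by
    intro x hx v hv a b hch
    have ha := hch.left_pos hx
    have hb := hch.right_pos hx
    simp only [hch.1.csInf_eq, hch.2.csSup_eq]
    set l := (a + b) / 2 with hl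
    set t := -(-a + b) / (b - -a) with ht
    have ht' : t = (a - b) / (a + b) := by rw [ht]; congr 1 <;> ring
    have hg : (fun s : ℝ => f (x + ((-a + b) / 2 + s * (b - -a) / 2) • v)) =
        fun s => f (x + ((-a + b) / 2) • v + s • (l • v)) := by
      funext s
      congr 1
      rw [hl]
      module
    have hx' : x + ((-a + b) / 2) • v + t • (l • v) = x := by
      rw [add_assoc, smul_smul, ← add_smul]
      have : (-a + b) / 2 + t * l = 0 := by
        rw [ht', hl]; field_simp; ring
      rw [this, zero_smul, add_zero]
    have hder : ∀ k : ℕ, (k : WithTop ℕ∞) ≤ 3 →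
        iteratedDeriv k (fun s : ℝ => f (x + ((-a + b) / 2 + s * (b - -a) / 2) • v)) t =
          l ^ k * iteratedFDeriv ℝ k f x (fun _ => v) := fun k hk => by
      rw [hg, iteratedDeriv_line isOpen_interior hf hk (by rwa [hx']), hx',
        iteratedFDeriv_const_smul]
    have hd1 := hder 1 (by norm_num)
    rw [iteratedDeriv_one, pow_one, iteratedFDeriv_one_apply] at hd1
    rw [hd1, hder 2 (by norm_num), hder 3 (by norm_num)]
    exact mem_Pset_iff_chordBounds hν ha hb hl ht'
  constructor
  · intro H
    have H' : ∀ x ∈ interior C, ∀ v : EuclideanSpace ℝ (Fin n), v ≠ 0 → ∀ a b,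
        IsChord C x v a b →
        ChordBounds √(ν - 1) (fderiv ℝ f x v) (iteratedFDeriv ℝ 2 f x (fun _ => v))
          (iteratedFDeriv ℝ 3 f x (fun _ => v)) a b :=
      fun x hx v hv a b hch => (hiff x hx v hv a b hch).1 (H x hx v hv)
    refine ⟨hf, fun x hx v hv => ?_, fun y hy => ?_, fun x hx v => ?_⟩
    · obtain ⟨a, b, hch⟩ := exists_isChord hCcpt (interior_subset hx) hv
      exact (H' x hx v hv a b hch).sub_sq_pos hμ (hch.left_pos hx) (hch.right_pos hx)
    · refine tendsto_atTop_of_le_fderiv (α := (2 * √(ν - 1) ^ 2)⁻¹) hCcpt hCconv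
        (fun x hx => (hf.contDiffAt (isOpen_interior.mem_nhds hx)).differentiableAt (by norm_num))
        (by positivity) (inv_le_one_of_one_le₀ (by nlinarith))
        (fun x hx v hv a b hch => (H' x hx v hv a b hch).le_first_deriv hμ) hy
    · rw [rpow_three_halves, sub_two_div_sqrt hν]
      rcases eq_or_ne v 0 with rfl | hv
      · have h0 : ∀ k : ℕ, k ≠ 0 → iteratedFDeriv ℝ k f x (fun _ => 0) = 0 := fun k hk => by
          have := iteratedFDeriv_const_smul f k x 0 0
          rwa [zero_smul, zero_pow hk, zero_mul] at this
        simp [h0]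
      · obtain ⟨a, b, hch⟩ := exists_isChord hCcpt (interior_subset hx) hv
        exact (H' x hx v hv a b hch).2.2.2.2
  · rintro ⟨-, hpos, hlim, hthird⟩ x hx v hv
    obtain ⟨a, b, hch⟩ := exists_isChord hCcpt (interior_subset hx) hv
    simp only [rpow_three_halves, sub_two_div_sqrt hν] at hthird
    obtain ⟨h1, h2⟩ := chord_right_bounds hμ hCconv hf hpos hlim hthird hx hv hch
    obtain ⟨h3, h4⟩ :=
      chord_right_bounds hμ hCconv hf hpos hlim hthird hx (neg_ne_zero.2 hv) hch.neg
    have hneg : iteratedFDeriv ℝ 2 f x (fun _ => -v) = iteratedFDeriv ℝ 2 f x (fun _ => v) := by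
      simpa using iteratedFDeriv_const_smul f 2 x v (-1)
    rw [hneg, map_neg, neg_sq] at h3 h4
    exact (hiff x hx v hv a b hch).2
      ⟨by linarith, by linarith, by linarith, by linarith, hthird x hx v⟩
end
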